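/- arXiv:2105.03466 — 12 statements merged into one kernel-verified Lean document; each statement's English description precedes it below -/
import Mathlib

section
/- Let n be a positive integer and let M be the n×n real matrix with entries M_{ij} = min(i,j). If w is any eigenvector of M corresponding to its largest eigenvalue, then (eᵀw)²/‖w‖² = cot²(π/(4n+2))/(2n+1), where e is the all-ones vector and ‖·‖ is the Euclidean norm. Equivalently, the Perron entropy of the rooted path P_n equals cot²(π/(4n+2))/(2n+1). -/
open Matrix

/-- The largest eigenvalue of a real square matrix (the supremum of its real
eigenvalues, i.e. of those `t` admitting a nonzero real eigenvector). -/
noncomputable def largestEigenvalue {n : ℕ} (M : Matrix (Fin n) (Fin n) ℝ) : ℝ :=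
  sSup {t : ℝ | ∃ v : Fin n → ℝ, v ≠ 0 ∧ M *ᵥ v = t • v}

lemma sin_rec (t : ℝ) (k : ℕ) :
    Real.sin (((k:ℝ) + 1) * t) * (2 - 2 * Real.cos t) =
      2 * Real.sin (((k:ℝ) + 1) * t) - Real.sin ((k:ℝ) * t) - Real.sin (((k:ℝ) + 2) * t) := by
  have h1 : (k:ℝ) * t = ((k:ℝ) + 1) * t - t := by ring
  have h2 : ((k:ℝ) + 2) * t = ((k:ℝ) + 1) * t + t := by ring
  rw [h1, h2, Real.sin_sub, Real.sin_add]
  ring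

lemma sum_diag (t : ℝ) (i : ℕ) :
    (∑ j ∈ Finset.range i, ((j:ℝ) + 1) * Real.sin (((j:ℝ) + 1) * t)) * (2 - 2 * Real.cos t) =
      Real.sin ((i:ℝ) * t) + i * (Real.sin ((i:ℝ) * t) - Real.sin (((i:ℝ) + 1) * t)) := by
  induction i with
  | zero => simp
  | succ i ih =>
    rw [Finset.sum_range_succ, add_mul, ih, mul_assoc, sin_rec]
    push_cast
    rw [show (i:ℝ) + 1 + 1 = i + 2 by ring]
    ring

lemma sum_min (t : ℝ) (i m : ℕ) (h : i ≤ m) :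
    (∑ j ∈ Finset.range m, min (i:ℝ) ((j:ℝ) + 1) * Real.sin (((j:ℝ) + 1) * t))
        * (2 - 2 * Real.cos t) =
      Real.sin ((i:ℝ) * t) + i * (Real.sin ((m:ℝ) * t) - Real.sin (((m:ℝ) + 1) * t)) := by
  induction m, h using Nat.le_induction with
  | base =>
    rw [← sum_diag]
    congr 1
    apply Finset.sum_congr rfl
    intro j hj
    have : (j:ℝ) + 1 ≤ i := by exact_mod_cast Finset.mem_range.1 hj
    rw [min_eq_right this]
  | succ m hm ih =>
    have : (i:ℝ) ≤ (m:ℝ) + 1 := by exact_mod_cast Nat.le_succ_of_le hm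
    rw [Finset.sum_range_succ, add_mul, ih, mul_assoc, sin_rec, min_eq_left this]
    push_cast
    rw [show (m:ℝ) + 1 + 1 = m + 2 by ring]
    ring

lemma sum_sin (x : ℝ) (n : ℕ) :
    (∑ j ∈ Finset.range n, Real.sin (((j:ℝ) + 1) * (2 * x))) * (2 * Real.sin x) =
      Real.cos x - Real.cos ((2 * n + 1) * x) := by
  induction n with
  | zero => simp
  | succ n ih =>
    rw [Finset.sum_range_succ, add_mul, ih]
    push_cast
    have h1 : (2 * (n:ℝ) + 1) * x = ((n:ℝ) + 1) * (2 * x) - x := by ring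
    have h2 : (2 * ((n:ℝ) + 1) + 1) * x = ((n:ℝ) + 1) * (2 * x) + x := by ring
    rw [h1, h2, Real.cos_sub, Real.cos_add]
    ring

lemma sum_sin_sq (t : ℝ) (n : ℕ) :
    (∑ j ∈ Finset.range n, Real.sin (((j:ℝ) + 1) * t) ^ 2) * (4 * Real.sin t) =
      (2 * n + 1) * Real.sin t - Real.sin ((2 * n + 1) * t) := by
  induction n with
  | zero => simp
  | succ n ih =>
    rw [Finset.sum_range_succ, add_mul, ih]
    push_cast
    have h1 : (2 * (n:ℝ) + 1) * t = 2 * (((n:ℝ) + 1) * t) - t := by ring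
    have h2 : (2 * ((n:ℝ) + 1) + 1) * t = 2 * (((n:ℝ) + 1) * t) + t := by ring
    rw [h1, h2, Real.sin_sub, Real.sin_add, Real.cos_two_mul]
    have := Real.sin_sq_add_cos_sq (((n:ℝ) + 1) * t)
    linear_combination (4 * Real.sin t) * this

lemma perron_bound {n : ℕ} (hn : 0 < n) (M : Matrix (Fin n) (Fin n) ℝ)
    (hM : ∀ i j, 0 < M i j) (v : Fin n → ℝ) (hv : ∀ i, 0 < v i) (l : ℝ)
    (hl : ∀ i, ∑ j, M i j * v j = l * v i) (u : Fin n → ℝ) (hu : u ≠ 0) (t : ℝ)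
    (ht : ∀ i, ∑ j, M i j * u j = t * u i) : t ≤ l := by
  have : Nonempty (Fin n) := ⟨⟨0, hn⟩⟩
  obtain ⟨i, hi⟩ := Finite.exists_max (fun i => |u i| / v i)
  have hb : ∀ j, |u j| ≤ |u i| / v i * v j := fun j => (div_le_iff₀ (hv j)).1 (hi j)
  have hpos : 0 < |u i| := by
    by_contra h
    have h0 : |u i| = 0 := le_antisymm (not_lt.1 h) (abs_nonneg _)
    apply hu
    funext j
    have := hb j
    rw [h0] at this
    simpa using this
  have key : |t| * |u i| ≤ l * |u i| := by
    calc |t| * |u i| = |∑ j, M i j * u j| := by rw [ht, abs_mul]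
      _ ≤ ∑ j, |M i j * u j| := Finset.abs_sum_le_sum_abs _ _
      _ ≤ ∑ j, |u i| / v i * (M i j * v j) := by
        apply Finset.sum_le_sum
        intro j _
        rw [abs_mul, abs_of_pos (hM i j)]
        calc _ ≤ M i j * (|u i| / v i * v j) := mul_le_mul_of_nonneg_left (hb j) (hM i j).le
          _ = _ := by ring
      _ = l * |u i| := by
        rw [← Finset.mul_sum, hl]
        have := (hv i).ne'
        field_simp
  exact (le_abs_self t).trans (le_of_mul_le_mul_right key hpos)

lemma perron_simple {n : ℕ} (hn : 0 < n) (M : Matrix (Fin n) (Fin n) ℝ)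
    (hM : ∀ i j, 0 < M i j) (v : Fin n → ℝ) (hv : ∀ i, 0 < v i) (l : ℝ)
    (hl : ∀ i, ∑ j, M i j * v j = l * v i) (u : Fin n → ℝ)
    (ht : ∀ i, ∑ j, M i j * u j = l * u i) : ∃ c : ℝ, ∀ i, u i = c * v i := by
  have : Nonempty (Fin n) := ⟨⟨0, hn⟩⟩
  obtain ⟨i, hi⟩ := Finite.exists_max (fun i => u i / v i)
  have hb : ∀ j, u j ≤ u i / v i * v j := fun j => (div_le_iff₀ (hv j)).1 (hi j)
  refine ⟨u i / v i, fun j => ?_⟩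
  have h0 : ∑ j, M i j * (u i / v i * v j - u j) = 0 := by
    have : ∀ j, M i j * (u i / v i * v j - u j) = u i / v i * (M i j * v j) - M i j * u j :=
      fun j => by ring
    simp_rw [this]
    rw [Finset.sum_sub_distrib, ← Finset.mul_sum, hl, ht]
    have := (hv i).ne'
    field_simp
    ring
  rw [Finset.sum_eq_zero_iff_of_nonneg
    (fun j _ => mul_nonneg (hM i j).le (sub_nonneg.2 (hb j)))] at h0
  have := h0 j (Finset.mem_univ _)
  rcases mul_eq_zero.1 this with h | h
  · exact absurd h (hM i j).ne'
  · linarith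

/-- For the bottleneck matrix `M` of the rooted path `P_n`
(`M i j = min (i+1) (j+1)`), any eigenvector `w` for the largest eigenvalue of `M`
satisfies `(eᵀw)²/‖w‖² = cot²(π/(4n+2))/(2n+1)`; i.e. the Perron entropy of the
rooted path `P_n` equals `cot²(π/(4n+2))/(2n+1)`. -/
theorem perron_entropy_of_path (n : ℕ) (hn : 0 < n)
    (M : Matrix (Fin n) (Fin n) ℝ)
    (hM : ∀ i j : Fin n, M i j = min ((i : ℕ) + 1 : ℝ) ((j : ℕ) + 1 : ℝ))
    (w : Fin n → ℝ) (hw0 : w ≠ 0)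
    (hw : M *ᵥ w = largestEigenvalue M • w) :
    (∑ i, w i) ^ 2 / (∑ i, (w i) ^ 2) =
      Real.cot (Real.pi / (4 * n + 2)) ^ 2 / (2 * n + 1) := by
  have hn' : (0:ℝ) < n := by exact_mod_cast hn
  have hpi := Real.pi_pos
  set x : ℝ := Real.pi / (4 * n + 2) with hx
  have hx0 : 0 < x := by positivity
  have hxn : (2 * (n:ℝ) + 1) * x = Real.pi / 2 := by rw [hx]; field_simp; ring
  have hxlt : 2 * x < Real.pi := by nlinarith
  have hs : 0 < Real.sin x := Real.sin_pos_of_pos_of_lt_pi hx0 (by linarith)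
  have hs2 : 0 < Real.sin (2 * x) := Real.sin_pos_of_pos_of_lt_pi (by linarith) hxlt
  have hd : 0 < 2 - 2 * Real.cos (2 * x) := by
    rw [Real.cos_two_mul, Real.cos_sq']; nlinarith
  let v : Fin n → ℝ := fun j => Real.sin (((j:ℕ):ℝ) * (2 * x) + 2 * x)
  have hvdef : ∀ j, v j = Real.sin ((((j:ℕ):ℝ) + 1) * (2 * x)) := fun j => by
    simp only [v]; congr 1; ring
  have hv : ∀ i, 0 < v i := fun i => by
    rw [hvdef]
    have h1 : ((i:ℕ):ℝ) + 1 ≤ n := by exact_mod_cast i.2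
    apply Real.sin_pos_of_pos_of_lt_pi (by positivity)
    nlinarith
  have hMpos : ∀ i j, 0 < M i j := fun i j => by rw [hM]; positivity
  set l : ℝ := 1 / (2 - 2 * Real.cos (2 * x)) with hldef
  have hl : ∀ i, ∑ j, M i j * v j = l * v i := fun i => by
    have h := sum_min (2 * x) ((i:ℕ) + 1) n i.2
    have he : Real.sin ((n:ℝ) * (2 * x)) = Real.sin (((n:ℝ) + 1) * (2 * x)) := by
      rw [← Real.sin_pi_sub]; congr 1; linear_combination (-2) * hxn
    rw [he, sub_self, mul_zero, add_zero] at h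
    simp_rw [hM, hvdef]
    rw [Fin.sum_univ_eq_sum_range (fun j : ℕ => min (((i:ℕ):ℝ) + 1) ((j:ℝ) + 1) *
      Real.sin (((j:ℝ) + 1) * (2 * x))) n, hldef]
    push_cast at h
    rw [div_mul_eq_mul_div, one_mul, eq_div_iff hd.ne']
    exact h
  have hmul : ∀ (u : Fin n → ℝ) (t : ℝ), M *ᵥ u = t • u ↔ ∀ i, ∑ j, M i j * u j = t * u i := by
    intro u t
    rw [funext_iff]
    rfl
  have hlam : largestEigenvalue M = l := by
    apply IsGreatest.csSup_eq
    constructor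
    · refine ⟨v, ?_, (hmul v l).2 hl⟩
      intro h
      have := hv ⟨0, hn⟩
      rw [h] at this
      simp at this
    · rintro t ⟨u, hu, ht⟩
      exact perron_bound hn M hMpos v hv l hl u hu t ((hmul u t).1 ht)
  rw [hlam] at hw
  obtain ⟨c, hc⟩ := perron_simple hn M hMpos v hv l hl w ((hmul w l).1 hw)
  have hc0 : c ≠ 0 := by
    rintro rfl
    exact hw0 (funext fun i => by simp [hc])
  have hS1 : ∑ i, v i = Real.cot x / 2 := by
    simp_rw [hvdef]
    rw [Fin.sum_univ_eq_sum_range (fun j : ℕ => Real.sin (((j:ℝ) + 1) * (2 * x))) n]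
    have h := sum_sin x n
    rw [hxn, Real.cos_pi_div_two, sub_zero] at h
    rw [Real.cot_eq_cos_div_sin, div_div, eq_div_iff (by positivity), mul_comm (Real.sin x) 2]
    exact h
  have hS2 : ∑ i, v i ^ 2 = (2 * n + 1) / 4 := by
    simp_rw [hvdef]
    rw [Fin.sum_univ_eq_sum_range (fun j : ℕ => Real.sin (((j:ℝ) + 1) * (2 * x)) ^ 2) n]
    have h := sum_sin_sq (2 * x) n
    rw [show (2 * (n:ℝ) + 1) * (2 * x) = Real.pi by linear_combination 2 * hxn,
      Real.sin_pi, sub_zero] at h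
    apply mul_right_cancel₀ hs2.ne'
    linarith
  simp_rw [hc, mul_pow]
  rw [← Finset.mul_sum, ← Finset.mul_sum, hS1, hS2]
  field_simp
  try ring
end

section
/- Let (T,r) be a rooted tree of order n and let N be its path matrix. Then N is invertible, and its inverse X = [x_{ij}] is given by: x_{ij} = 1 if i = j; x_{ij} = −1 if i is adjacent to j and j ⪯ i; and x_{ij} = 0 otherwise. -/
open Matrix SimpleGraph
open scoped Kronecker

attribute [local instance 10] Classical.propDecidable

/-- A rooted tree: a tree (connected acyclic simple graph) with a distinguished root. -/
structure RTree (V : Type) where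
  G : SimpleGraph V
  isTree : G.IsTree
  root : V

namespace RTree

variable {V : Type}

/-- `T.pord j i` means `j ⪯ i`: the (unique) path joining `j` to the root contains `i`. -/
def pord (T : RTree V) (j i : V) : Prop :=
  T.G.dist j T.root = T.G.dist j i + T.G.dist i T.root

/-- The path matrix `N`: the `(i,j)` entry is `1` if `j ⪯ i` and `0` otherwise. -/
noncomputable def pathMatrix (T : RTree V) : Matrix V V ℝ :=
  Matrix.of fun i j => if T.pord j i then 1 else 0

/-- The bottleneck matrix `M = NᵀN`: the `(i,j)` entry is the number of vertices lying
simultaneously on the path from `i` to the root and on the path from `j` to the root. -/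
noncomputable def bottleneck (T : RTree V) : Matrix V V ℝ :=
  Matrix.of fun i j => (Nat.card {v : V | T.pord i v ∧ T.pord j v} : ℝ)

/-- The neckbottle matrix `Q = N Nᵀ`. -/
noncomputable def neckbottle [Fintype V] (T : RTree V) : Matrix V V ℝ :=
  T.pathMatrix * T.pathMatrixᵀ

/-- The Perron value of a rooted tree: the largest eigenvalue of its bottleneck matrix. -/
noncomputable def perron [Fintype V] (T : RTree V) : ℝ :=
  sSup {t : ℝ | ∃ w : V → ℝ, w ≠ 0 ∧ T.bottleneck *ᵥ w = t • w}

/-- The degree of a vertex. -/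
noncomputable def degree (T : RTree V) (v : V) : ℕ :=
  Nat.card {u : V | T.G.Adj v u}

/-- The moment `μ(T) = ∑ᵥ dist(v, root) · deg(v)`. -/
noncomputable def moment [Fintype V] (T : RTree V) : ℕ :=
  ∑ v : V, T.G.dist v T.root * T.degree v

/-- The root-transmission `t(T) = ∑ᵥ dist(v, root)`. -/
noncomputable def transmission [Fintype V] (T : RTree V) : ℕ :=
  ∑ v : V, T.G.dist v T.root

end RTree

/-- A vertex has at most one neighbour on its path to the root. -/
theorem RTree.parent_unique {V : Type} (T : RTree V) {j k l : V}
    (hk : T.G.Adj k j) (hl : T.G.Adj l j) (pk : T.pord j k) (pl : T.pord j l) : k = l := by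
  have hc := T.isTree.1
  obtain ⟨p, hp⟩ := hc.exists_walk_length_eq_dist k T.root
  obtain ⟨q, hq⟩ := hc.exists_walk_length_eq_dist l T.root
  unfold RTree.pord at pk pl
  have h1 : T.G.dist j k = 1 := SimpleGraph.dist_eq_one_iff_adj.2 hk.symm
  have h2 : T.G.dist j l = 1 := SimpleGraph.dist_eq_one_iff_adj.2 hl.symm
  have hp' : (Walk.cons hk.symm p).IsPath :=
    Walk.isPath_of_length_eq_dist _ (by simp only [Walk.length_cons]; omega)
  have hq' : (Walk.cons hl.symm q).IsPath :=
    Walk.isPath_of_length_eq_dist _ (by simp only [Walk.length_cons]; omega)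
  have h := congrArg (fun w => (w : T.G.Walk j T.root).snd)
    ((T.isTree.existsUnique_path j T.root).unique hp' hq')
  simpa using h

theorem RTree.exists_parent {V : Type} (T : RTree V) {i j : V} (hij : i ≠ j)
    (h : T.pord j i) : ∃ k, T.G.Adj k j ∧ T.pord j k ∧ T.pord k i := by
  have hc := T.isTree.1
  obtain ⟨p, hp⟩ := hc.exists_walk_length_eq_dist j i
  cases p with
  | nil => exact absurd rfl hij
  | @cons _ k _ hk p =>
    have h1 : T.G.dist j k = 1 := SimpleGraph.dist_eq_one_iff_adj.2 hk
    have h2 := SimpleGraph.dist_le p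
    have h3 := hc.dist_triangle (u := j) (v := k) (w := T.root)
    have h4 := hc.dist_triangle (u := k) (v := i) (w := T.root)
    simp only [Walk.length_cons] at hp
    unfold RTree.pord at *
    exact ⟨k, hk.symm, by omega, by omega⟩

theorem RTree.pord_of_parent {V : Type} (T : RTree V) {i j k : V}
    (hk : T.G.Adj k j) (pk : T.pord j k) (h : T.pord k i) : T.pord j i ∧ i ≠ j := by
  have hc := T.isTree.1
  have h1 : T.G.dist j k = 1 := SimpleGraph.dist_eq_one_iff_adj.2 hk.symm
  have h3 := hc.dist_triangle (u := j) (v := k) (w := i)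
  have h4 := hc.dist_triangle (u := j) (v := i) (w := T.root)
  unfold RTree.pord at *
  refine ⟨by omega, ?_⟩
  rintro rfl
  omega

theorem RTree.pord_self {V : Type} (T : RTree V) (i : V) : T.pord i i := by
  simp [RTree.pord]

/-- The path matrix `N` of a rooted tree is invertible, with inverse
`X` given by: `x i j = 1` if `i = j`; `x i j = -1` if `i ~ j` and `j ⪯ i`; `x i j = 0`
otherwise. -/
theorem pathMatrix_inverse {V : Type} [Fintype V] (T : RTree V)
    (X : Matrix V V ℝ)
    (hX : ∀ i j : V, X i j =
      if i = j then 1 else if T.G.Adj i j ∧ T.pord j i then -1 else 0) :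
    T.pathMatrix * X = 1 ∧ X * T.pathMatrix = 1 := by
  have key : T.pathMatrix * X = 1 := by
    ext i j
    rw [Matrix.mul_apply, Matrix.one_apply]
    simp only [RTree.pathMatrix, Matrix.of_apply]
    by_cases hpar : ∃ k, T.G.Adj k j ∧ T.pord j k
    · obtain ⟨k, hk, pk⟩ := hpar
      have hX' : ∀ l, X l j = (if l = j then 1 else 0) - (if l = k then 1 else 0) := by
        intro l
        rw [hX]
        by_cases hlj : l = j
        · subst hlj
          simp [hk.ne']
        · by_cases hlk : l = k
          · subst hlk
            simp [hlj, hk, pk]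
          · have : ¬ (T.G.Adj l j ∧ T.pord j l) :=
              fun h => hlk (T.parent_unique h.1 hk h.2 pk)
            simp [hlj, hlk, this]
      simp only [hX', mul_sub, Finset.sum_sub_distrib, mul_ite, mul_one, mul_zero,
        Finset.sum_ite_eq', Finset.mem_univ, if_true]
      by_cases hij : i = j
      · subst hij
        have : ¬ T.pord k i := fun h => (T.pord_of_parent hk pk h).2 rfl
        simp [this, T.pord_self]
      · have : T.pord j i ↔ T.pord k i := by
          refine ⟨fun h => ?_, fun h => (T.pord_of_parent hk pk h).1⟩
          obtain ⟨l, hl, pl, hli⟩ := T.exists_parent hij h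
          rwa [T.parent_unique hk hl pk pl]
        simp [this, hij]
    · have hX' : ∀ l, X l j = if l = j then 1 else 0 := by
        intro l
        rw [hX, if_neg (fun h => hpar ⟨l, h⟩)]
      simp only [hX', mul_ite, mul_one, mul_zero,
        Finset.sum_ite_eq', Finset.mem_univ, if_true]
      by_cases hij : i = j
      · subst hij
        simp [T.pord_self]
      · have : ¬ T.pord j i := fun h => by
          obtain ⟨l, hl, pl, _⟩ := T.exists_parent hij h
          exact hpar ⟨l, hl, pl⟩
        simp [this, hij]
  exact ⟨key, mul_eq_one_comm.1 key⟩
end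

section
/- Let (T,r) be a rooted tree of order n with path matrix N, and let Q = NNᵀ be its neckbottle matrix. Then Q is invertible and its inverse Y = [y_{ij}] is given by: y_{ij} = 1 if i = j = r; y_{ij} = 2 if i = j ≠ r; y_{ij} = −1 if i is adjacent to j; y_{ij} = 1 if i and j are brothers; and y_{ij} = 0 otherwise. -/
open Matrix SimpleGraph
open scoped Kronecker

attribute [local instance 10] Classical.propDecidable

/-- Two vertices `i, j` are brothers if `i ≠ j`, they are equidistant from the root,
and they have a common neighbour. -/
def RTree.brothers {V : Type} (T : RTree V) (i j : V) : Prop :=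
  i ≠ j ∧ T.G.dist i T.root = T.G.dist j T.root ∧ ∃ k : V, T.G.Adj i k ∧ T.G.Adj j k

namespace RTree

/-- `i` is the parent of `j`. -/
def par {V : Type} (T : RTree V) (i j : V) : Prop :=
  T.G.Adj i j ∧ T.G.dist j T.root = T.G.dist i T.root + 1

theorem exists_step {V : Type} (T : RTree V) {i j : V} (h : j ≠ i) :
    ∃ q, T.G.Adj q j ∧ T.G.dist j i = T.G.dist q i + 1 := by
  obtain ⟨w, hw⟩ := T.isTree.connected.exists_walk_length_eq_dist j i
  cases w with
  | nil => exact absurd rfl h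
  | @cons _ q _ hadj p =>
    refine ⟨q, hadj.symm, ?_⟩
    have h1 := dist_le p
    have h2 := T.isTree.connected.dist_triangle (u := j) (v := q) (w := i)
    have h3 := dist_eq_one_iff_adj.mpr hadj
    simp only [Walk.length_cons] at hw
    omega

theorem par_unique {V : Type} (T : RTree V) {i k j : V} (hi : T.par i j) (hk : T.par k j) :
    i = k := by
  obtain ⟨p, hp⟩ := T.isTree.connected.exists_walk_length_eq_dist i T.root
  obtain ⟨q, hq⟩ := T.isTree.connected.exists_walk_length_eq_dist k T.root
  have h1 : (Walk.cons hi.1.symm p).IsPath := by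
    apply Walk.isPath_of_length_eq_dist
    rw [Walk.length_cons, hp, hi.2]
  have h2 : (Walk.cons hk.1.symm q).IsPath := by
    apply Walk.isPath_of_length_eq_dist
    rw [Walk.length_cons, hq, hk.2]
  have h := (T.isTree.existsUnique_path j T.root).unique h1 h2
  have h' := congrArg Walk.snd h
  simpa using h'

theorem exists_par {V : Type} (T : RTree V) {j : V} (h : j ≠ T.root) : ∃ i, T.par i j :=
  T.exists_step h

theorem adj_iff {V : Type} (T : RTree V) (i j : V) : T.G.Adj i j ↔ T.par i j ∨ T.par j i := by
  constructor
  · intro h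
    have := T.isTree.dist_eq_dist_add_one_of_adj T.root h
    rw [dist_comm, dist_comm (u := T.root) (v := j)] at this
    rcases this with h1 | h1
    · exact Or.inr ⟨h.symm, by omega⟩
    · exact Or.inl ⟨h, by omega⟩
  · rintro (h | h)
    · exact h.1
    · exact h.1.symm

theorem brothers_iff {V : Type} (T : RTree V) (i j : V) :
    T.brothers i j ↔ i ≠ j ∧ ∃ k, T.par k i ∧ T.par k j := by
  constructor
  · rintro ⟨hne, hd, k, h1, h2⟩
    refine ⟨hne, k, ?_⟩
    rcases (T.adj_iff i k).1 h1 with a | a <;> rcases (T.adj_iff j k).1 h2 with b | b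
    · exact absurd (T.par_unique a b) hne
    · have := a.2; have := b.2; omega
    · have := a.2; have := b.2; omega
    · exact ⟨a, b⟩
  · rintro ⟨hne, k, h1, h2⟩
    exact ⟨hne, by rw [h1.2, h2.2], k, h1.1.symm, h2.1.symm⟩

theorem pord_par {V : Type} (T : RTree V) {i j p : V} (hp : T.par p j) :
    T.pord j i ↔ j = i ∨ T.pord p i := by
  unfold pord
  have t1 := T.isTree.connected.dist_triangle (u := j) (v := i) (w := T.root)
  have t2 := T.isTree.connected.dist_triangle (u := j) (v := p) (w := i)
  have t3 := dist_eq_one_iff_adj.mpr hp.1.symm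
  have t4 := hp.2
  constructor
  · intro h
    by_cases hji : j = i
    · exact Or.inl hji
    right
    obtain ⟨q, hq, hd⟩ := T.exists_step hji
    have t5 := T.isTree.connected.dist_triangle (u := q) (v := i) (w := T.root)
    have t6 := T.isTree.connected.dist_triangle (u := j) (v := q) (w := T.root)
    have t7 := dist_eq_one_iff_adj.mpr hq.symm
    have hpq : p = q := T.par_unique hp ⟨hq, by omega⟩
    subst hpq
    omega
  · rintro (h | h)
    · subst h; simp
    · omega

theorem not_pord_par {V : Type} (T : RTree V) {j p : V} (hp : T.par p j) : ¬ T.pord p j := by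
  unfold pord
  have t4 := hp.2
  omega

theorem pord_root {V : Type} (T : RTree V) (i : V) : T.pord T.root i ↔ i = T.root := by
  unfold pord
  rw [dist_self]
  constructor
  · intro h
    exact (T.isTree.connected.dist_eq_zero_iff).1 (by omega)
  · rintro rfl
    simp

theorem not_par_root {V : Type} (T : RTree V) (i : V) : ¬ T.par i T.root := by
  rintro ⟨-, h⟩
  simp at h

/-- The inverse of the path matrix. -/
noncomputable def linv {V : Type} (T : RTree V) : Matrix V V ℝ :=
  Matrix.of fun i j => (if i = j then 1 else 0) - (if T.par i j then 1 else 0)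

theorem sum_par {V : Type} [Fintype V] (T : RTree V) {p j : V} (hp : T.par p j) (f : V → ℝ) :
    ∑ k, f k * (if T.par k j then 1 else 0) = f p := by
  rw [Finset.sum_eq_single p]
  · simp [hp]
  · intro b _ hb
    rw [if_neg, mul_zero]
    intro h
    exact hb (T.par_unique h hp)
  · simp

theorem sum_linv {V : Type} [Fintype V] (T : RTree V) (j : V) (f : V → ℝ) :
    ∑ k, f k * T.linv k j = f j - ∑ k, f k * (if T.par k j then 1 else 0) := by
  simp only [linv, Matrix.of_apply, mul_sub, Finset.sum_sub_distrib]
  simp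

theorem path_mul_linv {V : Type} [Fintype V] (T : RTree V) : T.pathMatrix * T.linv = 1 := by
  ext i j
  rw [Matrix.mul_apply, sum_linv, Matrix.one_apply]
  by_cases hj : j = T.root
  · subst hj
    simp [not_par_root, pathMatrix, pord_root]
  · obtain ⟨p, hp⟩ := T.exists_par hj
    rw [T.sum_par hp]
    simp only [pathMatrix, Matrix.of_apply, T.pord_par hp]
    by_cases hij : i = j
    · subst hij
      simp [T.not_pord_par hp]
    · have : ¬ j = i := fun h => hij h.symm
      simp [hij, this]

theorem linv_gram {V : Type} [Fintype V] (T : RTree V) (i j : V) :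
    (T.linvᵀ * T.linv) i j =
      if i = j ∧ i = T.root then 1
      else if i = j then 2
      else if T.G.Adj i j then -1
      else if T.brothers i j then 1
      else 0 := by
  rw [Matrix.mul_apply, sum_linv]
  simp only [Matrix.transpose_apply, T.adj_iff, T.brothers_iff]
  by_cases hj : j = T.root
  · subst hj
    simp only [not_par_root, linv, Matrix.of_apply]
    by_cases hij : i = T.root
    · subst hij; simp [not_par_root]
    · have : ¬ T.root = i := fun h => hij h.symm
      by_cases h : T.par T.root i <;> simp [hij, this, h]
  · obtain ⟨p, hp⟩ := T.exists_par hj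
    rw [T.sum_par hp]
    have hpp : ∀ k, T.par k j ↔ k = p := fun k =>
      ⟨fun h => T.par_unique h hp, fun h => h ▸ hp⟩
    have hpj : p ≠ j := hp.1.ne
    have hjj : ¬ T.par j j := fun h => h.1.ne rfl
    simp only [linv, Matrix.of_apply, hpp]
    by_cases hij : i = j
    · subst hij
      simp [hj, hjj, hp, hpj]
      norm_num
    · have hji : ¬ j = i := fun h => hij h.symm
      by_cases hip : i = p
      · subst hip
        have h1 : ¬ T.par j i := fun h => by have := h.2; have := hp.2; omega
        have h2 : ¬ T.par i i := fun h => h.1.ne rfl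
        simp [hij, hji, h1, h2]
      · have hpi : ¬ p = i := fun h => hip h.symm
        by_cases h1 : T.par j i
        · have h2 : ¬ T.par p i := fun h => hpj (T.par_unique h h1)
          simp [hij, hji, hip, hpi, h1, h2]
        · by_cases h2 : T.par p i <;> simp [hij, hji, hip, hpi, h1, h2]

end RTree

/-- The neckbottle matrix `Q = NNᵀ` of a rooted tree is invertible,
with inverse `Y` given by: `y i j = 1` if `i = j = root`; `y i j = 2` if `i = j ≠ root`;
`y i j = -1` if `i ~ j`; `y i j = 1` if `i, j` are brothers; `y i j = 0` otherwise. -/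
theorem neckbottle_inverse {V : Type} [Fintype V] (T : RTree V)
    (Y : Matrix V V ℝ)
    (hY : ∀ i j : V, Y i j =
      if i = j ∧ i = T.root then 1
      else if i = j then 2
      else if T.G.Adj i j then -1
      else if T.brothers i j then 1
      else 0) :
    T.neckbottle * Y = 1 ∧ Y * T.neckbottle = 1 := by
  have hYL : Y = T.linvᵀ * T.linv := by
    ext i j
    rw [hY, T.linv_gram]
  have h1 := T.path_mul_linv
  have h2 : T.linv * T.pathMatrix = 1 := mul_eq_one_comm.mp h1
  have h : T.neckbottle * Y = 1 := by
    rw [hYL, RTree.neckbottle]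
    calc T.pathMatrix * T.pathMatrixᵀ * (T.linvᵀ * T.linv)
        = T.pathMatrix * (T.linv * T.pathMatrix)ᵀ * T.linv := by
          rw [Matrix.transpose_mul]; simp only [Matrix.mul_assoc]
      _ = 1 := by rw [h2, Matrix.transpose_one, Matrix.mul_one, h1]
  exact ⟨h, mul_eq_one_comm.mp h⟩
end

section
/- Let T_1,…,T_k be rooted trees of orders n_1,…,n_k and let n = n_1 + … + n_k + 1. Then max_{1≤i≤k} ρ(T_i) ≤ ρ(⊞_{i=1}^k T_i) ≤ max_{1≤i≤k} ρ(T_i) + n, where ⊞_{i=1}^k T_i is the rooted sum of T_1,…,T_k. -/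
open Matrix SimpleGraph
open scoped Kronecker

attribute [local instance 10] Classical.propDecidable

section PerronAux

/-- A function that changes by at most one along edges is bounded by the distance. -/
lemma lip_dist {W : Type} (G : SimpleGraph W) (hG : G.Connected) (f : W → ℕ)
    (hf : ∀ x y, G.Adj x y → f y ≤ f x + 1) (u v : W) : f v ≤ f u + G.dist u v := by
  obtain ⟨p, hp⟩ := hG.exists_walk_length_eq_dist u v
  rw [← hp]
  clear hp
  induction p with
  | nil => simp
  | cons h p ih =>
    have := hf _ _ h
    simp only [SimpleGraph.Walk.length_cons]
    omega

lemma eig_bdd {W : Type} [Fintype W] (M : Matrix W W ℝ) :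
    BddAbove {t : ℝ | ∃ w : W → ℝ, w ≠ 0 ∧ M *ᵥ w = t • w} := by
  refine Set.Finite.bddAbove (Set.Finite.subset
    (Module.End.finite_hasEigenvalue (Matrix.mulVecLin M)) ?_)
  rintro t ⟨w, hw, h⟩
  exact Module.End.hasEigenvalue_of_hasEigenvector
    (x := w) ⟨Module.End.mem_eigenspace_iff.mpr (by simpa using h), hw⟩

lemma bot_symm {W : Type} (T : RTree W) : T.bottleneck.IsHermitian := by
  ext i j
  simp [RTree.bottleneck, and_comm]

lemma quad_le {W : Type} [Fintype W] (T : RTree W) (w : W → ℝ) :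
    w ⬝ᵥ (T.bottleneck *ᵥ w) ≤ T.perron * (w ⬝ᵥ w) := by
  have hH : (T.perron • (1 : Matrix W W ℝ) - T.bottleneck).IsHermitian := by
    refine Matrix.IsHermitian.sub ?_ (bot_symm T)
    ext i j
    simp [Matrix.one_apply, eq_comm]
  have hP : (T.perron • (1 : Matrix W W ℝ) - T.bottleneck).PosSemidef := by
    rw [hH.posSemidef_iff_eigenvalues_nonneg]
    intro i
    have h1 := hH.mulVec_eigenvectorBasis i
    set v : W → ℝ := (hH.eigenvectorBasis i).ofLp with hv
    have hv0 : v ≠ 0 := by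
      intro h0
      apply hH.eigenvectorBasis.toBasis.ne_zero i
      simp only [OrthonormalBasis.coe_toBasis]
      ext j
      exact congrFun h0 j
    rw [Matrix.sub_mulVec, Matrix.smul_mulVec, Matrix.one_mulVec] at h1
    have h2 : T.bottleneck *ᵥ v = (T.perron - hH.eigenvalues i) • v := by
      rw [sub_smul, ← h1]; abel
    have := le_csSup (eig_bdd T.bottleneck) ⟨v, hv0, h2⟩
    change _ ≤ T.perron at this
    simp only [Pi.zero_apply]
    linarith
  have := hP.dotProduct_mulVec_nonneg w
  rw [Matrix.sub_mulVec, Matrix.smul_mulVec, Matrix.one_mulVec, dotProduct_sub,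
    dotProduct_smul] at this
  simp at this
  linarith

lemma perron_le_of {W : Type} [Fintype W] (T : RTree W) (c : ℝ)
    (hc : ∀ w, w ⬝ᵥ (T.bottleneck *ᵥ w) ≤ c * (w ⬝ᵥ w)) : T.perron ≤ c := by
  have hne : {t : ℝ | ∃ w : W → ℝ, w ≠ 0 ∧ T.bottleneck *ᵥ w = t • w}.Nonempty := by
    have hH := bot_symm T
    refine ⟨hH.eigenvalues T.root, (hH.eigenvectorBasis T.root).ofLp, ?_,
      hH.mulVec_eigenvectorBasis T.root⟩
    intro h0
    apply hH.eigenvectorBasis.toBasis.ne_zero T.root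
    simp only [OrthonormalBasis.coe_toBasis]
    ext j
    exact congrFun h0 j
  refine csSup_le hne ?_
  rintro t ⟨w, hw, h⟩
  have h1 := hc w
  rw [h, dotProduct_smul, smul_eq_mul] at h1
  have h2 : 0 < w ⬝ᵥ w := by
    have h3 : w ⬝ᵥ w ≠ 0 := fun h => hw (dotProduct_self_eq_zero.mp h)
    have h4 : 0 ≤ w ⬝ᵥ w := Finset.sum_nonneg fun i _ => mul_self_nonneg _
    exact lt_of_le_of_ne h4 h3.symm
  exact le_of_mul_le_mul_right h1 h2

lemma perron_nonneg {W : Type} [Fintype W] (T : RTree W) : 0 ≤ T.perron := by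
  have h := quad_le T (Pi.single T.root 1)
  simp only [Matrix.mulVec_single_one, single_dotProduct, one_mul, Pi.single_eq_same,
    mul_one] at h
  refine le_trans ?_ h
  simp [RTree.bottleneck]

end PerronAux

section SumAux

variable {k : ℕ} {V : Fin k → Type} [∀ i, Fintype (V i)] (T : ∀ i, RTree (V i))
    (S : RTree (Unit ⊕ (Σ i : Fin k, V i)))
    (hroot : S.root = Sum.inl ())
    (hadj : ∀ x y : Unit ⊕ (Σ i : Fin k, V i), S.G.Adj x y ↔
      ((∃ (i : Fin k) (a b : V i),
          (T i).G.Adj a b ∧ x = Sum.inr ⟨i, a⟩ ∧ y = Sum.inr ⟨i, b⟩) ∨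
        (∃ i : Fin k, x = Sum.inl () ∧ y = Sum.inr ⟨i, (T i).root⟩) ∨
        (∃ i : Fin k, x = Sum.inr ⟨i, (T i).root⟩ ∧ y = Sum.inl ())))

/-- Distance from `a` in the `i`-th part; truncated outside. -/
noncomputable def auxDist (i : Fin k) (a : V i) : (Unit ⊕ (Σ i : Fin k, V i)) → ℕ
  | Sum.inl _ => (T i).G.dist a (T i).root + 1
  | Sum.inr ⟨j, b⟩ => if h : j = i then (T i).G.dist a (h ▸ b) else (T i).G.dist a (T i).root + 1

include hadj in
lemma auxDist_le (i : Fin k) (a : V i) (y : Unit ⊕ (Σ i : Fin k, V i)) :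
    auxDist T i a y ≤ S.G.dist (Sum.inr ⟨i, a⟩) y := by
  have h := lip_dist S.G S.isTree.1 (auxDist T i a) ?_ (Sum.inr ⟨i, a⟩) y
  · simpa [auxDist] using h
  · intro x y hxy
    rw [hadj] at hxy
    rcases hxy with ⟨j, b, c, hbc, rfl, rfl⟩ | ⟨j, rfl, rfl⟩ | ⟨j, rfl, rfl⟩
    · by_cases hj : j = i
      · subst hj
        have h1 := (T j).isTree.1.dist_triangle (u := a) (v := b) (w := c)
        have h2 := SimpleGraph.dist_eq_one_iff_adj.mpr hbc
        simp only [auxDist, dite_true]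
        omega
      · simp [auxDist, hj]
    · by_cases hj : j = i
      · subst hj
        simp [auxDist]
        omega
      · simp [auxDist, hj]
    · by_cases hj : j = i
      · subst hj
        simp [auxDist]
      · simp [auxDist, hj]

include hadj in
lemma dist_inr (i : Fin k) (a b : V i) :
    S.G.dist (Sum.inr ⟨i, a⟩) (Sum.inr ⟨i, b⟩) = (T i).G.dist a b := by
  apply le_antisymm
  · obtain ⟨p, hp⟩ := (T i).isTree.1.exists_walk_length_eq_dist a b
    let f : (T i).G →g S.G := ⟨fun x => Sum.inr ⟨i, x⟩, fun {x y} h =>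
      (hadj _ _).mpr (Or.inl ⟨i, x, y, h, rfl, rfl⟩)⟩
    rw [← hp, ← SimpleGraph.Walk.length_map f p]
    exact SimpleGraph.dist_le _
  · simpa [auxDist] using auxDist_le T S hadj i a (Sum.inr ⟨i, b⟩)

include hadj in
lemma dist_inl (i : Fin k) (a : V i) :
    S.G.dist (Sum.inr ⟨i, a⟩) (Sum.inl ()) = (T i).G.dist a (T i).root + 1 := by
  apply le_antisymm
  · have h1 := S.isTree.1.dist_triangle (u := Sum.inr ⟨i, a⟩) (v := Sum.inr ⟨i, (T i).root⟩)
      (w := Sum.inl ())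
    rw [dist_inr T S hadj] at h1
    have h2 : S.G.Adj (Sum.inr ⟨i, (T i).root⟩) (Sum.inl ()) :=
      (hadj _ _).mpr (Or.inr (Or.inr ⟨i, rfl, rfl⟩))
    rw [SimpleGraph.dist_eq_one_iff_adj.mpr h2] at h1
    exact h1
  · simpa [auxDist] using auxDist_le T S hadj i a (Sum.inl ())

include hroot in
lemma pord_to_root (x) : S.pord x (Sum.inl ()) := by
  simp [RTree.pord, hroot]

include hroot hadj in
lemma pord_from_root (i : Fin k) (a : V i) : ¬ S.pord (Sum.inl ()) (Sum.inr ⟨i, a⟩) := by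
  simp [RTree.pord, hroot, dist_inl T S hadj]

include hroot hadj in
lemma pord_same (i : Fin k) (a b : V i) :
    S.pord (Sum.inr ⟨i, a⟩) (Sum.inr ⟨i, b⟩) ↔ (T i).pord a b := by
  simp only [RTree.pord, hroot, dist_inl T S hadj, dist_inr T S hadj]
  omega

include hroot hadj in
lemma pord_diff (i j : Fin k) (hij : j ≠ i) (a : V i) (b : V j) :
    ¬ S.pord (Sum.inr ⟨i, a⟩) (Sum.inr ⟨j, b⟩) := by
  have h := auxDist_le T S hadj i a (Sum.inr ⟨j, b⟩)
  simp only [auxDist, hij, dite_false] at h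
  simp only [RTree.pord, hroot, dist_inl T S hadj]
  omega

include hroot hadj in
lemma bot_left (y) : S.bottleneck (Sum.inl ()) y = 1 := by
  have : {v | S.pord (Sum.inl ()) v ∧ S.pord y v} = {Sum.inl ()} := by
    ext v
    rcases v with ⟨⟩ | ⟨i, a⟩
    · simp [pord_to_root S hroot]
    · simp [pord_from_root T S hroot hadj]
  simp only [RTree.bottleneck, Matrix.of_apply, this]
  simp

include hroot hadj in
lemma bot_diff (i j : Fin k) (hij : i ≠ j) (a : V i) (b : V j) :
    S.bottleneck (Sum.inr ⟨i, a⟩) (Sum.inr ⟨j, b⟩) = 1 := by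
  have : {v | S.pord (Sum.inr ⟨i, a⟩) v ∧ S.pord (Sum.inr ⟨j, b⟩) v} = {Sum.inl ()} := by
    ext v
    rcases v with ⟨⟩ | ⟨l, c⟩
    · simp [pord_to_root S hroot]
    · by_cases h : l = i
      · have := pord_diff T S hroot hadj j l (h ▸ hij) b c
        simp [this]
      · have := pord_diff T S hroot hadj i l h a c
        simp [this]
  simp only [RTree.bottleneck, Matrix.of_apply, this]
  simp

include hroot hadj in
lemma bot_same (i : Fin k) (a b : V i) :
    S.bottleneck (Sum.inr ⟨i, a⟩) (Sum.inr ⟨i, b⟩) = 1 + (T i).bottleneck a b := by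
  let g : V i → Unit ⊕ (Σ i : Fin k, V i) := fun c => Sum.inr ⟨i, c⟩
  have hg : Function.Injective g := fun x y h => by simpa [g] using h
  have : {v | S.pord (Sum.inr ⟨i, a⟩) v ∧ S.pord (Sum.inr ⟨i, b⟩) v}
      = insert (Sum.inl ()) (g '' {v | (T i).pord a v ∧ (T i).pord b v}) := by
    ext v
    rcases v with ⟨⟩ | ⟨l, c⟩
    · simp [pord_to_root S hroot]
    · by_cases h : l = i
      · subst h
        simp [pord_same T S hroot hadj, g]
      · have := pord_diff T S hroot hadj i l h a c
        simp only [Set.mem_setOf_eq, this, false_and, false_iff]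
        rintro (h1 | ⟨d, -, h1⟩)
        · cases h1
        · simp only [g, Sum.inr.injEq, Sigma.mk.injEq] at h1
          exact h h1.1.symm
  simp only [RTree.bottleneck, Matrix.of_apply, this, Nat.card_coe_set_eq]
  rw [Set.ncard_insert_of_notMem (by simp [g]) (Set.toFinite _), Set.ncard_image_of_injective _ hg]
  push_cast
  ring

include hroot hadj in
lemma quad_sum (w : Unit ⊕ (Σ i : Fin k, V i) → ℝ) :
    w ⬝ᵥ (S.bottleneck *ᵥ w) = (∑ x, w x) ^ 2 +
      ∑ i, (fun a => w (Sum.inr ⟨i, a⟩)) ⬝ᵥ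
        ((T i).bottleneck *ᵥ (fun a => w (Sum.inr ⟨i, a⟩))) := by
  have hl : (S.bottleneck *ᵥ w) (Sum.inl ()) = ∑ x, w x := by
    simp only [Matrix.mulVec, dotProduct, bot_left T S hroot hadj, one_mul]
  have hr : ∀ (i : Fin k) (a : V i), (S.bottleneck *ᵥ w) (Sum.inr ⟨i, a⟩) = ∑ x, w x +
      ((T i).bottleneck *ᵥ (fun a => w (Sum.inr ⟨i, a⟩))) a := by
    intro i a
    simp only [Matrix.mulVec, dotProduct, Fintype.sum_sum_type, Fintype.sum_sigma]
    have h0 : S.bottleneck (Sum.inr ⟨i, a⟩) (Sum.inl ()) = 1 := by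
      have := (bot_symm S).apply (Sum.inr ⟨i, a⟩) (Sum.inl ())
      rw [← this, bot_left T S hroot hadj]; simp
    have h1 : ∀ j, ∑ b : V j, S.bottleneck (Sum.inr ⟨i, a⟩) (Sum.inr ⟨j, b⟩) * w (Sum.inr ⟨j, b⟩)
        = ∑ b : V j, w (Sum.inr ⟨j, b⟩) +
          if j = i then ∑ b : V i, (T i).bottleneck a b * w (Sum.inr ⟨i, b⟩) else 0 := by
      intro j
      by_cases h : j = i
      · subst h
        simp [bot_same T S hroot hadj, add_mul, Finset.sum_add_distrib]
      · simp [bot_diff T S hroot hadj i j (Ne.symm h), h]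
    simp only [h1, Finset.sum_add_distrib]
    simp [h0]
    ring
  conv_lhs => rw [dotProduct]
  simp only [Fintype.sum_sum_type, Fintype.sum_sigma, Finset.univ_unique, Finset.sum_singleton,
    PUnit.default_eq_unit, hl, hr, mul_add, Finset.sum_add_distrib, dotProduct,
    ← Finset.sum_mul]
  ring

lemma norm_sum (w : Unit ⊕ (Σ i : Fin k, V i) → ℝ) :
    w ⬝ᵥ w = w (Sum.inl ()) ^ 2 +
      ∑ i, (fun a => w (Sum.inr ⟨i, a⟩)) ⬝ᵥ (fun a => w (Sum.inr ⟨i, a⟩)) := by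
  simp [dotProduct, Fintype.sum_sum_type, Fintype.sum_sigma, sq]

end SumAux

/-- If `S` is the rooted sum of rooted trees `T 1, …, T k` (all their
roots joined to a new root vertex) and `n = n₁ + … + n_k + 1` is its order, then
`max_i ρ(T i) ≤ ρ(S) ≤ max_i ρ(T i) + n`. -/
theorem perron_rooted_sum {k : ℕ} (hk : 0 < k) {V : Fin k → Type}
    [∀ i, Fintype (V i)] (T : ∀ i, RTree (V i))
    (S : RTree (Unit ⊕ (Σ i : Fin k, V i)))
    (hroot : S.root = Sum.inl ())
    (hadj : ∀ x y : Unit ⊕ (Σ i : Fin k, V i), S.G.Adj x y ↔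
      ((∃ (i : Fin k) (a b : V i),
          (T i).G.Adj a b ∧ x = Sum.inr ⟨i, a⟩ ∧ y = Sum.inr ⟨i, b⟩) ∨
        (∃ i : Fin k, x = Sum.inl () ∧ y = Sum.inr ⟨i, (T i).root⟩) ∨
        (∃ i : Fin k, x = Sum.inr ⟨i, (T i).root⟩ ∧ y = Sum.inl ())))
    (n : ℕ) (hn : n = (∑ i, Fintype.card (V i)) + 1) :
    (⨆ i, (T i).perron) ≤ S.perron ∧ S.perron ≤ (⨆ i, (T i).perron) + n := by
  haveI : Nonempty (Fin k) := ⟨⟨0, hk⟩⟩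
  constructor
  · refine ciSup_le fun i => perron_le_of (T i) _ fun u => ?_
    let w : Unit ⊕ (Σ i : Fin k, V i) → ℝ := Sum.elim (fun _ => 0)
      (fun p => if h : p.1 = i then u (h ▸ p.2) else 0)
    have hwi : (fun a => w (Sum.inr ⟨i, a⟩)) = u := by
      funext a; simp [w]
    have hwj : ∀ j, j ≠ i → (fun a => w (Sum.inr ⟨j, a⟩)) = 0 := by
      intro j hj; funext a; simp [w, hj]
    have h := quad_le S w
    rw [quad_sum T S hroot hadj, norm_sum, Finset.sum_eq_single i, Finset.sum_eq_single i,
      hwi] at h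
    · have h0 : w (Sum.inl ()) = 0 := rfl
      rw [h0] at h
      have := sq_nonneg (∑ x, w x)
      simp only [ne_eq, OfNat.ofNat_ne_zero, not_false_eq_true, zero_pow, zero_add] at h
      linarith
    · intro j _ hj; rw [hwj j hj]; simp
    · simp
    · intro j _ hj; rw [hwj j hj]; simp
    · simp
  · refine perron_le_of S _ fun w => ?_
    have hbd : BddAbove (Set.range fun i => (T i).perron) := (Set.finite_range _).bddAbove
    set R := ⨆ i, (T i).perron with hR
    have hR0 : 0 ≤ R := le_trans (perron_nonneg (T ⟨0, hk⟩)) (le_ciSup hbd ⟨0, hk⟩)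
    have h1 : (∑ x, w x) ^ 2 ≤ n * (w ⬝ᵥ w) := by
      have := sq_sum_le_card_mul_sum_sq (s := Finset.univ) (f := w)
      have hc : ((Finset.univ : Finset (Unit ⊕ (Σ i : Fin k, V i))).card : ℝ) = n := by
        rw [hn]
        simp [Finset.card_univ, add_comm]
      rw [hc] at this
      simpa [dotProduct, sq] using this
    have h2 : ∑ i, (fun a => w (Sum.inr ⟨i, a⟩)) ⬝ᵥ
        ((T i).bottleneck *ᵥ (fun a => w (Sum.inr ⟨i, a⟩))) ≤
        R * ∑ i, (fun a => w (Sum.inr ⟨i, a⟩)) ⬝ᵥ (fun a => w (Sum.inr ⟨i, a⟩)) := by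
      rw [Finset.mul_sum]
      refine Finset.sum_le_sum fun i _ => (quad_le (T i) _).trans ?_
      exact mul_le_mul_of_nonneg_right (le_ciSup hbd i)
        (Finset.sum_nonneg fun a _ => mul_self_nonneg _)
    have h3 := mul_nonneg hR0 (sq_nonneg (w (Sum.inl ())))
    have h4 := norm_sum w
    rw [quad_sum T S hroot hadj, add_mul]
    have h5 : R * (w ⬝ᵥ w) = R * w (Sum.inl ()) ^ 2 + R *
      ∑ i, (fun a => w (Sum.inr ⟨i, a⟩)) ⬝ᵥ (fun a => w (Sum.inr ⟨i, a⟩)) := by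
      rw [h4, mul_add]
    linarith
end

section
/- Let T_1,…,T_k be rooted trees of orders n_1,…,n_k and let n = n_1 + … + n_k + 1. Then μ(⊞_{i=1}^k T_i) = Σ_{i=1}^k μ(T_i) + 2n − 2 − k, where ⊞_{i=1}^k T_i is the rooted sum of T_1,…,T_k. -/
open Matrix SimpleGraph
open scoped Kronecker

attribute [local instance 10] Classical.propDecidable

theorem rs_sum_degree {V : Type} [Fintype V] (T : RTree V) :
    (∑ v, T.degree v) + 2 = 2 * Fintype.card V := by
  have h1 := T.G.sum_degrees_eq_twice_card_edges
  have h2 := T.isTree.card_edgeFinset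
  have h3 : ∀ v, T.degree v = T.G.degree v := by
    intro v
    rw [← SimpleGraph.card_neighborSet_eq_degree, ← Nat.card_eq_fintype_card]
    rfl
  simp only [h3]
  omega

theorem rs_pot {W : Type} (G : SimpleGraph W) (f : W → ℕ)
    (hf : ∀ x y, G.Adj x y → f x ≤ f y + 1) {x y : W} (p : G.Walk x y) :
    f x ≤ f y + p.length := by
  induction p with
  | nil => simp
  | cons h p ih =>
    have := hf _ _ h
    simp only [SimpleGraph.Walk.length_cons]
    omega

/-- If `S` is the rooted sum of rooted trees `T 1, …, T k` (all their
roots joined to a new root vertex) and `n = n₁ + … + n_k + 1` is its order, then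
`μ(S) = ∑ᵢ μ(T i) + 2n − 2 − k`. -/
theorem moment_rooted_sum {k : ℕ} (hk : 0 < k) {V : Fin k → Type}
    [∀ i, Fintype (V i)] (T : ∀ i, RTree (V i))
    (S : RTree (Unit ⊕ (Σ i : Fin k, V i)))
    (hroot : S.root = Sum.inl ())
    (hadj : ∀ x y : Unit ⊕ (Σ i : Fin k, V i), S.G.Adj x y ↔
      ((∃ (i : Fin k) (a b : V i),
          (T i).G.Adj a b ∧ x = Sum.inr ⟨i, a⟩ ∧ y = Sum.inr ⟨i, b⟩) ∨
        (∃ i : Fin k, x = Sum.inl () ∧ y = Sum.inr ⟨i, (T i).root⟩) ∨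
        (∃ i : Fin k, x = Sum.inr ⟨i, (T i).root⟩ ∧ y = Sum.inl ())))
    (n : ℕ) (hn : n = (∑ i, Fintype.card (V i)) + 1) :
    (S.moment : ℝ) = (∑ i, ((T i).moment : ℝ)) + 2 * n - 2 - k := by
  have hc : ∀ (i : Fin k) (a b : V i), (T i).G.Adj a b →
      S.G.Adj (Sum.inr ⟨i, a⟩) (Sum.inr ⟨i, b⟩) := fun i a b h =>
    (hadj _ _).2 (Or.inl ⟨i, a, b, h, rfl, rfl⟩)
  have hr : ∀ i, S.G.Adj (Sum.inr ⟨i, (T i).root⟩) (Sum.inl ()) := fun i =>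
    (hadj _ _).2 (Or.inr (Or.inr ⟨i, rfl, rfl⟩))
  have hdist : ∀ i (a : V i), S.G.dist (Sum.inr ⟨i, a⟩) (Sum.inl ()) =
      (T i).G.dist a (T i).root + 1 := by
    intro i a
    apply le_antisymm
    · obtain ⟨p, hp⟩ := (T i).isTree.connected.exists_walk_length_eq_dist a (T i).root
      let φ : (T i).G →g S.G := ⟨fun a => Sum.inr ⟨i, a⟩, fun {a b} h => hc i a b h⟩
      have := SimpleGraph.dist_le ((p.map φ).concat (hr i))
      rw [SimpleGraph.Walk.length_concat, SimpleGraph.Walk.length_map, hp] at this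
      exact this
    · obtain ⟨p, hp⟩ := S.isTree.connected.exists_walk_length_eq_dist
        (Sum.inr ⟨i, a⟩) (Sum.inl ())
      have := rs_pot S.G (Sum.elim (fun _ => 0)
        (fun v => (T v.1).G.dist v.2 (T v.1).root + 1)) ?_ p
      · simpa [hp] using this
      · intro x y hxy
        rcases (hadj x y).1 hxy with ⟨j, b, c, h, rfl, rfl⟩ | ⟨j, rfl, rfl⟩ | ⟨j, rfl, rfl⟩
        · have h1 := (T j).isTree.connected.dist_triangle (u := b) (v := c) (w := (T j).root)
          have h2 := SimpleGraph.dist_eq_one_iff_adj.2 h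
          simp only [Sum.elim_inr]
          omega
        · simp
        · simp
  have hdeg : ∀ i (a : V i), S.degree (Sum.inr ⟨i, a⟩) =
      (T i).degree a + if a = (T i).root then 1 else 0 := by
    intro i a
    have hinj : Function.Injective (fun b : V i =>
        (Sum.inr ⟨i, b⟩ : Unit ⊕ (Σ i : Fin k, V i))) := by
      intro b c h
      simpa using h
    have hset : {u | S.G.Adj (Sum.inr ⟨i, a⟩) u} =
        Set.image (fun b : V i => (Sum.inr ⟨i, b⟩ : Unit ⊕ (Σ i : Fin k, V i)))
          {b | (T i).G.Adj a b} ∪ (if a = (T i).root then {Sum.inl ()} else ∅) := by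
      ext u
      simp only [Set.mem_setOf_eq, Set.mem_union, Set.mem_image]
      constructor
      · intro h
        rcases (hadj _ _).1 h with ⟨j, b, c, h, h1, rfl⟩ | ⟨j, h1, rfl⟩ | ⟨j, h1, rfl⟩
        · cases h1
          exact Or.inl ⟨c, h, rfl⟩
        · cases h1
        · cases h1
          right
          simp
      · rintro (⟨b, h, rfl⟩ | h)
        · exact hc i a b h
        · split_ifs at h with ha
          · obtain rfl := h
            rw [ha]
            exact hr i
          · exact h.elim
    unfold RTree.degree
    rw [Nat.card_coe_set_eq, Nat.card_coe_set_eq, hset, Set.ncard_union_eq,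
      Set.ncard_image_of_injective _ hinj]
    · split_ifs <;> simp
    · rw [Set.disjoint_left]
      rintro _ ⟨b, _, rfl⟩ h
      split_ifs at h <;> simp at h
  have hμ : ∀ i, (∑ a : V i, S.G.dist (Sum.inr ⟨i, a⟩) (Sum.inl ()) *
      S.degree (Sum.inr ⟨i, a⟩)) + 1 = (T i).moment + 2 * Fintype.card (V i) := by
    intro i
    rw [← rs_sum_degree (T i)]
    have : ∀ a : V i, S.G.dist (Sum.inr ⟨i, a⟩) (Sum.inl ()) * S.degree (Sum.inr ⟨i, a⟩) =
        (T i).G.dist a (T i).root * (T i).degree a + (T i).degree a +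
          if a = (T i).root then 1 else 0 := by
      intro a
      rw [hdist, hdeg]
      split_ifs with ha
      · subst ha
        simp
      · ring
    simp only [this, Finset.sum_add_distrib, Finset.sum_ite_eq', Finset.mem_univ, if_true,
      RTree.moment]
    ring
  have hS : S.moment = ∑ i, ∑ a : V i, S.G.dist (Sum.inr ⟨i, a⟩) (Sum.inl ()) *
      S.degree (Sum.inr ⟨i, a⟩) := by
    simp [RTree.moment, hroot, Fintype.sum_sum_type, Fintype.sum_sigma]
  have hfin : S.moment + k = ∑ i, (T i).moment + 2 * ∑ i, Fintype.card (V i) := by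
    have := Finset.sum_congr (rfl : (Finset.univ : Finset (Fin k)) = Finset.univ)
      (fun i _ => hμ i)
    rw [Finset.sum_add_distrib, Finset.sum_add_distrib, ← Finset.mul_sum] at this
    rw [hS]
    simpa using this
  have hfinR : (S.moment : ℝ) + k = ∑ i, ((T i).moment : ℝ) +
      2 * ((∑ i, Fintype.card (V i) : ℕ) : ℝ) := by
    exact_mod_cast hfin
  rw [hn]
  push_cast at hfinR ⊢
  linarith
end

section
/- Let p ≥ 1 and k ≥ 2 be integers. Then the Perron value of the rooted Bethe tree B_{p,k} satisfies ρ(B_{p,k}) ≤ (k^{p+1} − pk − k + p)/(k−1)². -/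
open Matrix SimpleGraph
open scoped Kronecker

attribute [local instance 10] Classical.propDecidable

/-- In the complete `k`-ary tree on words over `Fin k` of length `< p`, `x` is the
parent of `y` if `y` is obtained from `x` by appending one more letter. -/
def IsParent {p k : ℕ} (x y : (l : Fin p) × (Fin (l : ℕ) → Fin k)) : Prop :=
  ∃ h : (y.1 : ℕ) = (x.1 : ℕ) + 1,
    ∀ j : Fin (x.1 : ℕ), x.2 j = y.2 (Fin.castLE (by omega) j)


/-- Vertices of the complete `k`-ary tree. -/
abbrev BV (p k : ℕ) : Type := (l : Fin p) × (Fin (l : ℕ) → Fin k)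

/-- `v` is a prefix of `j`. -/
def Pre {p k : ℕ} (v j : BV p k) : Prop :=
  (v.1 : ℕ) ≤ (j.1 : ℕ) ∧
    ∀ (a : ℕ) (h1 : a < (v.1 : ℕ)) (h2 : a < (j.1 : ℕ)), v.2 ⟨a, h1⟩ = j.2 ⟨a, h2⟩

lemma walk_level {p k : ℕ} (G : SimpleGraph (BV p k))
    (hadj : ∀ x y : BV p k, G.Adj x y ↔ IsParent x y ∨ IsParent y x)
    {j v : BV p k} (w : G.Walk j v) : (j.1 : ℕ) ≤ w.length + (v.1 : ℕ) := by
  induction w with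
  | nil => simp
  | cons h w ih =>
    rw [SimpleGraph.Walk.length_cons]
    rcases (hadj _ _).1 h with ⟨h1, _⟩ | ⟨h1, _⟩ <;> omega

lemma walk_pre {p k : ℕ} (G : SimpleGraph (BV p k))
    (hadj : ∀ x y : BV p k, G.Adj x y ↔ IsParent x y ∨ IsParent y x)
    {j v : BV p k} (w : G.Walk j v) (hw : w.length + (v.1 : ℕ) ≤ (j.1 : ℕ)) : Pre v j := by
  induction w with
  | nil => exact ⟨le_rfl, fun a h1 h2 => rfl⟩
  | cons h w ih =>
    have hl := walk_level G hadj w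
    rw [SimpleGraph.Walk.length_cons] at hw
    rcases (hadj _ _).1 h with ⟨h1, _⟩ | ⟨h1, h2⟩
    · omega
    · obtain ⟨i1, i2⟩ := ih (by omega)
      refine ⟨by omega, fun a ha hb => ?_⟩
      rw [i2 a ha (by omega)]
      exact h2 ⟨a, by omega⟩

lemma exists_walk {p k : ℕ} (hp : 1 ≤ p) (G : SimpleGraph (BV p k))
    (hadj : ∀ x y : BV p k, G.Adj x y ↔ IsParent x y ∨ IsParent y x) (n : ℕ) :
    ∀ j : BV p k, (j.1 : ℕ) = n →
      ∃ w : G.Walk j (⟨⟨0, hp⟩, Fin.elim0⟩ : BV p k), w.length = n := by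
  induction n with
  | zero =>
    rintro ⟨⟨l, hl⟩, f⟩ h
    simp only at h
    subst h
    have : f = Fin.elim0 := by
      funext a
      exact a.elim0
    subst this
    exact ⟨SimpleGraph.Walk.nil, rfl⟩
  | succ n ih =>
    rintro ⟨⟨l, hl⟩, f⟩ h
    simp only at h
    subst h
    obtain ⟨w, hw⟩ := ih ⟨⟨n, by omega⟩, fun a => f (Fin.castLE (by simp) a)⟩ rfl
    have ha : G.Adj ⟨⟨n + 1, hl⟩, f⟩ ⟨⟨n, by omega⟩, fun a => f (Fin.castLE (by simp) a)⟩ :=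
      (hadj _ _).2 (Or.inr ⟨rfl, fun a => rfl⟩)
    refine ⟨SimpleGraph.Walk.cons ha w, ?_⟩
    simp [hw]

lemma pord_pre {p k : ℕ} (hp : 1 ≤ p) (B : RTree (BV p k))
    (hroot : B.root = ⟨⟨0, hp⟩, Fin.elim0⟩)
    (hadj : ∀ x y : BV p k, B.G.Adj x y ↔ IsParent x y ∨ IsParent y x)
    {j v : BV p k} (h : B.pord j v) : Pre v j := by
  unfold RTree.pord at h
  obtain ⟨w1, hw1⟩ := exists_walk hp B.G hadj _ j rfl
  have h1 := SimpleGraph.dist_le w1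
  rw [hw1, ← hroot] at h1
  obtain ⟨w2, hw2⟩ := B.isTree.1.exists_walk_length_eq_dist v B.root
  have h2 := walk_level B.G hadj w2
  have h3 : (B.root.1 : ℕ) = 0 := by rw [hroot]
  obtain ⟨w3, hw3⟩ := B.isTree.1.exists_walk_length_eq_dist j v
  exact walk_pre B.G hadj w3 (by omega)

/-- number of extensions of a word of length `l` to length `m` -/
lemma card_ext {p k : ℕ} (v : BV p k) (m : Fin p) :
    Nat.card {u : Fin (m : ℕ) → Fin k // Pre v ⟨m, u⟩} ≤
      if (v.1 : ℕ) ≤ (m : ℕ) then k ^ ((m : ℕ) - (v.1 : ℕ)) else 0 := by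
  split_ifs with h
  · have := Nat.card_le_card_of_injective
      (fun (u : {u : Fin (m : ℕ) → Fin k // Pre v ⟨m, u⟩}) (b : Fin ((m : ℕ) - (v.1 : ℕ))) =>
        u.1 ⟨(v.1 : ℕ) + b, by omega⟩) ?_
    · simpa using this
    · rintro ⟨u, hu⟩ ⟨u', hu'⟩ he
      apply Subtype.ext
      funext a
      by_cases ha : (a : ℕ) < (v.1 : ℕ)
      · exact (hu.2 a ha a.2).symm.trans (hu'.2 a ha a.2)
      · have := congrFun he ⟨(a : ℕ) - (v.1 : ℕ), by omega⟩
        have e : (v.1 : ℕ) + ((a : ℕ) - (v.1 : ℕ)) = a := by omega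
        simpa [e] using this
  · have : IsEmpty {u : Fin (m : ℕ) → Fin k // Pre v ⟨m, u⟩} := ⟨fun u => h u.2.1⟩
    simp

lemma card_anc {p k : ℕ} (i : BV p k) (l : Fin p) :
    Nat.card {w : Fin (l : ℕ) → Fin k // Pre ⟨l, w⟩ i} ≤ 1 := by
  rw [Finite.card_le_one_iff_subsingleton]
  constructor
  rintro ⟨u, hu⟩ ⟨u', hu'⟩
  apply Subtype.ext
  funext a
  have h : (a : ℕ) < (i.1 : ℕ) := lt_of_lt_of_le a.2 hu.1
  exact (hu.2 a a.2 h).trans (hu'.2 a a.2 h).symm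

lemma sum_ind {α : Type*} [Fintype α] (P : α → Prop) :
    ∑ a, (if P a then 1 else 0 : ℕ) = Nat.card {a // P a} := by
  rw [Nat.card_eq_fintype_card, Fintype.card_subtype, Finset.card_filter]

lemma row_sum {p k : ℕ} (i : BV p k) :
    ∑ j : BV p k, Nat.card {v : BV p k // Pre v i ∧ Pre v j} ≤
      ∑ l : Fin p, ∑ m : Fin p, if (l : ℕ) ≤ (m : ℕ) then k ^ ((m : ℕ) - (l : ℕ)) else 0 := by
  calc ∑ j : BV p k, Nat.card {v : BV p k // Pre v i ∧ Pre v j}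
      = ∑ v : BV p k, (if Pre v i then 1 else 0) * ∑ j : BV p k, (if Pre v j then 1 else 0) := by
        simp_rw [← sum_ind, Finset.mul_sum]
        rw [Finset.sum_comm]
        refine Finset.sum_congr rfl fun v _ => Finset.sum_congr rfl fun j _ => ?_
        by_cases h1 : Pre v i <;> by_cases h2 : Pre v j <;> simp [h1, h2]
    _ ≤ ∑ v : BV p k, (if Pre v i then 1 else 0) *
          ∑ m : Fin p, (if (v.1 : ℕ) ≤ (m : ℕ) then k ^ ((m : ℕ) - (v.1 : ℕ)) else 0) := by
        refine Finset.sum_le_sum fun v _ => Nat.mul_le_mul_left _ ?_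
        rw [Fintype.sum_sigma]
        refine Finset.sum_le_sum fun m _ => ?_
        rw [sum_ind]
        exact card_ext v m
    _ ≤ _ := by
        rw [Fintype.sum_sigma]
        refine Finset.sum_le_sum fun l _ => ?_
        change ∑ y : Fin (l : ℕ) → Fin k, (if Pre ⟨l, y⟩ i then 1 else 0) *
          (∑ m : Fin p, if (l : ℕ) ≤ (m : ℕ) then k ^ ((m : ℕ) - (l : ℕ)) else 0) ≤ _
        rw [← Finset.sum_mul, sum_ind]
        exact (Nat.mul_le_mul_right _ (card_anc i l)).trans (by simp)

lemma geom_aux (k : ℕ) (p : ℕ) :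
    ((k : ℝ) - 1) * ∑ l ∈ Finset.range p, (k : ℝ) ^ (p - l) = (k : ℝ) ^ (p + 1) - k := by
  induction p with
  | zero => simp
  | succ p ih =>
    rw [Finset.sum_range_succ', mul_add]
    simp only [Nat.add_sub_add_right, Nat.sub_zero]
    rw [ih]
    ring

lemma closed_form (k p : ℕ) :
    ((k : ℝ) - 1) ^ 2 * ∑ l ∈ Finset.range p, ∑ m ∈ Finset.range p,
      (if l ≤ m then (k : ℝ) ^ (m - l) else 0) = (k : ℝ) ^ (p + 1) - p * k - k + p := by
  induction p with
  | zero => simp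
  | succ p ih =>
    rw [Finset.sum_range_succ]
    have e1 : ∑ m ∈ Finset.range (p + 1), (if p ≤ m then (k : ℝ) ^ (m - p) else 0) = 1 := by
      rw [Finset.sum_range_succ, Finset.sum_eq_zero]
      · simp
      · intro m hm
        rw [if_neg]
        have := Finset.mem_range.1 hm
        omega
    have e2 : ∑ l ∈ Finset.range p, ∑ m ∈ Finset.range (p + 1),
        (if l ≤ m then (k : ℝ) ^ (m - l) else 0) =
        (∑ l ∈ Finset.range p, ∑ m ∈ Finset.range p,
        (if l ≤ m then (k : ℝ) ^ (m - l) else 0)) + ∑ l ∈ Finset.range p, (k : ℝ) ^ (p - l) := by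
      rw [← Finset.sum_add_distrib]
      refine Finset.sum_congr rfl fun l hl => ?_
      rw [Finset.sum_range_succ, if_pos (Finset.mem_range.1 hl).le]
    rw [e1, e2]
    have g := geom_aux k p
    push_cast
    linear_combination ih + ((k : ℝ) - 1) * g

lemma eig_bound {V : Type} [Fintype V] (M : Matrix V V ℝ) (hM : ∀ i j, 0 ≤ M i j) (R : ℝ)
    (hR : ∀ i, ∑ j, M i j ≤ R) (t : ℝ) (w : V → ℝ) (hw : w ≠ 0) (h : M *ᵥ w = t • w) :
    t ≤ R := by
  obtain ⟨i0, hi0⟩ := Function.ne_iff.1 hw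
  obtain ⟨i, -, hi⟩ := Finset.exists_max_image Finset.univ (fun i => |w i|) ⟨i0, Finset.mem_univ _⟩
  have hpos : 0 < |w i| := lt_of_lt_of_le (abs_pos.2 hi0) (hi i0 (Finset.mem_univ _))
  have h1 : ∑ j, M i j * w j = t * w i := congrFun h i
  have h2 : t * |w i| ≤ R * |w i| := by
    calc t * |w i| ≤ |t| * |w i| := by gcongr; exact le_abs_self t
      _ = |∑ j, M i j * w j| := by rw [h1, abs_mul]
      _ ≤ ∑ j, |M i j * w j| := Finset.abs_sum_le_sum_abs _ _
      _ ≤ ∑ j, M i j * |w i| := by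
        refine Finset.sum_le_sum fun j _ => ?_
        rw [abs_mul, abs_of_nonneg (hM i j)]
        exact mul_le_mul_of_nonneg_left (hi j (Finset.mem_univ _)) (hM i j)
      _ = (∑ j, M i j) * |w i| := by rw [Finset.sum_mul]
      _ ≤ R * |w i| := by gcongr; exact hR i
  exact le_of_mul_le_mul_right h2 hpos

/-- For integers `p ≥ 1` and `k ≥ 2`, the Perron value of the rooted
Bethe tree `B_{p,k}` (the complete `k`-ary rooted tree whose vertices are the words over
`Fin k` of length `< p`, rooted at the empty word, a word being joined to its
one-letter extensions) satisfies `ρ(B_{p,k}) ≤ (k^{p+1} − pk − k + p)/(k−1)²`. -/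
theorem perron_bethe_tree (p k : ℕ) (hp : 1 ≤ p) (hk : 2 ≤ k)
    (B : RTree ((l : Fin p) × (Fin (l : ℕ) → Fin k)))
    (hroot : B.root = ⟨⟨0, hp⟩, Fin.elim0⟩)
    (hadj : ∀ x y : (l : Fin p) × (Fin (l : ℕ) → Fin k),
      B.G.Adj x y ↔ IsParent x y ∨ IsParent y x) :
    B.perron ≤ ((k : ℝ) ^ (p + 1) - p * k - k + p) / ((k : ℝ) - 1) ^ 2 := by
  have hkpos : (0 : ℝ) < ((k : ℝ) - 1) ^ 2 := by
    have : (2 : ℝ) ≤ k := by exact_mod_cast hk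
    have : (0 : ℝ) < (k : ℝ) - 1 := by linarith
    positivity
  rw [← closed_form k p, mul_div_cancel_left₀ _ hkpos.ne']
  apply Real.sSup_le
  · rintro t ⟨w, hw, h⟩
    refine eig_bound B.bottleneck (fun i j => ?_) _ (fun i => ?_) t w hw h
    · simp [RTree.bottleneck]
    · have h1 : ∑ j, B.bottleneck i j ≤
          ((∑ j : BV p k, Nat.card {v : BV p k // Pre v i ∧ Pre v j} : ℕ) : ℝ) := by
        push_cast
        refine Finset.sum_le_sum fun j _ => ?_
        simp only [RTree.bottleneck, Matrix.of_apply]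
        norm_cast
        exact Nat.card_mono (Set.toFinite {v : BV p k | Pre v i ∧ Pre v j})
          (fun v hv => ⟨pord_pre hp B hroot hadj hv.1, pord_pre hp B hroot hadj hv.2⟩)
      have h2 : ((∑ j : BV p k, Nat.card {v : BV p k // Pre v i ∧ Pre v j} : ℕ) : ℝ) ≤ _ :=
        Nat.cast_le.2 (row_sum i)
      refine (h1.trans h2).trans (le_of_eq ?_)
      rw [Finset.sum_range]
      simp_rw [Finset.sum_range]
      push_cast
      rfl
  · positivity
end

section
/- Let p ≥ 1 and k ≥ 2 be integers. Then the moment of the rooted Bethe tree B_{p,k} satisfies μ(B_{p,k}) = (2pk^{p+1} − 3k^{p+1} − 2pk^p + k^p + k² + k)/(k−1)². -/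
open Matrix SimpleGraph
open scoped Kronecker

attribute [local instance 10] Classical.propDecidable

theorem exists_parent_aux {p k : ℕ} (x : (l : Fin p) × (Fin (l : ℕ) → Fin k))
    (h : 1 ≤ (x.1 : ℕ)) : ∃ u, IsParent u x := by
  obtain ⟨⟨l, hl⟩, f⟩ := x
  obtain ⟨m, rfl⟩ : ∃ m, l = m + 1 := ⟨l - 1, by simp at h; omega⟩
  exact ⟨⟨⟨m, by omega⟩, fun j => f (Fin.castLE (by simp) j)⟩, rfl, fun j => rfl⟩

theorem parent_unique_aux {p k : ℕ} {x u v : (l : Fin p) × (Fin (l : ℕ) → Fin k)}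
    (hu : IsParent u x) (hv : IsParent v x) : u = v := by
  obtain ⟨⟨a, ha⟩, f⟩ := u
  obtain ⟨⟨b, hb⟩, g⟩ := v
  obtain ⟨h1, h2⟩ := hu
  obtain ⟨h3, h4⟩ := hv
  obtain rfl : a = b := by simp at h1 h3; omega
  have : f = g := funext fun j => (h2 j).trans (h4 j).symm
  rw [this]

theorem children_card_aux {p k : ℕ} (x : (l : Fin p) × (Fin (l : ℕ) → Fin k)) :
    {u | IsParent x u}.ncard = if (x.1 : ℕ) + 1 < p then k else 0 := by
  obtain ⟨⟨l, hl⟩, f⟩ := x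
  split_ifs with h
  · simp only at h
    let F : Fin k → ((l : Fin p) × (Fin (l : ℕ) → Fin k)) :=
      fun c => ⟨⟨l + 1, h⟩, (Fin.snoc f c : Fin (l + 1) → Fin k)⟩
    have hF : Function.Injective F := by
      intro c d hcd
      have h1 := eq_of_heq (Sigma.mk.inj hcd).2
      have h2 := congrFun h1 (Fin.last l)
      simpa using h2
    have hr : {u | IsParent (⟨⟨l, hl⟩, f⟩ : (l : Fin p) × (Fin (l : ℕ) → Fin k)) u}
        = Set.range F := by
      ext u
      constructor
      · rintro ⟨h1, h2⟩
        obtain ⟨⟨m, hm⟩, g⟩ := u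
        obtain rfl : m = l + 1 := h1
        refine ⟨g (Fin.last l), ?_⟩
        have : (Fin.snoc f (g (Fin.last l)) : Fin (l + 1) → Fin k) = g := by
          funext j
          refine Fin.lastCases ?_ (fun j => ?_) j
          · simp
          · rw [Fin.snoc_castSucc]; exact h2 j
        simp only [F]
        rw [this]
      · rintro ⟨c, rfl⟩
        refine ⟨rfl, fun j => ?_⟩
        exact (Fin.snoc_castSucc (α := fun _ => Fin k) c f j).symm
    rw [hr, ← Nat.card_coe_set_eq, Nat.card_range_of_injective hF]
    simp
  · rw [Set.ncard_eq_zero]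
    ext u
    simp only [Set.mem_ofPred_eq, Set.mem_empty_iff_false, iff_false]
    rintro ⟨h1, -⟩
    have := u.1.2
    simp at h h1
    omega

theorem moment_sum_aux (k : ℝ) (hk : k - 1 ≠ 0) (q : ℕ) :
    ∑ l ∈ Finset.range q, k ^ l * (l * (1 + k)) + k ^ q * q =
      (2 * (q + 1 : ℝ) * k ^ (q + 2) - 3 * k ^ (q + 2) - 2 * (q + 1 : ℝ) * k ^ (q + 1)
          + k ^ (q + 1) + k ^ 2 + k) / (k - 1) ^ 2 := by
  induction q with
  | zero => field_simp; norm_num; ring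
  | succ n ih =>
    rw [Finset.sum_range_succ, eq_sub_of_add_eq ih]
    push_cast
    field_simp
    ring

/-- For integers `p ≥ 1` and `k ≥ 2`, the moment of the rooted Bethe
tree `B_{p,k}` (the complete `k`-ary rooted tree whose vertices are the words over
`Fin k` of length `< p`, rooted at the empty word, a word being joined to its
one-letter extensions) satisfies
`μ(B_{p,k}) = (2pk^{p+1} − 3k^{p+1} − 2pk^p + k^p + k² + k)/(k−1)²`. -/
theorem moment_bethe_tree (p k : ℕ) (hp : 1 ≤ p) (hk : 2 ≤ k)
    (B : RTree ((l : Fin p) × (Fin (l : ℕ) → Fin k)))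
    (hroot : B.root = ⟨⟨0, hp⟩, Fin.elim0⟩)
    (hadj : ∀ x y : (l : Fin p) × (Fin (l : ℕ) → Fin k),
      B.G.Adj x y ↔ IsParent x y ∨ IsParent y x) :
    (B.moment : ℝ) =
      (2 * p * (k : ℝ) ^ (p + 1) - 3 * (k : ℝ) ^ (p + 1) - 2 * p * (k : ℝ) ^ p
          + (k : ℝ) ^ p + (k : ℝ) ^ 2 + k) / ((k : ℝ) - 1) ^ 2 := by
  have hpar : ∀ x : (l : Fin p) × (Fin (l : ℕ) → Fin k), 1 ≤ (x.1 : ℕ) → ∃ u, IsParent u x := exists_parent_aux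
  have hup : ∀ n : ℕ, ∀ x : (l : Fin p) × (Fin (l : ℕ) → Fin k), (x.1 : ℕ) = n →
      B.G.dist x B.root ≤ n := by
    intro n
    induction n with
    | zero =>
      rintro ⟨⟨l, hl⟩, f⟩ hx
      obtain rfl : l = 0 := hx
      have : f = Fin.elim0 := funext fun j => Fin.elim0 j
      rw [hroot, this]
      simp
    | succ n ih =>
      intro x hx
      obtain ⟨u, hu⟩ := hpar x (by omega)
      have h1 := ih u (by have := hu.1; omega)
      have h2 : B.G.Adj x u := (hadj x u).2 (Or.inr hu)
      have h3 := B.isTree.1.dist_triangle (u := x) (v := u) (w := B.root)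
      have h4 := SimpleGraph.dist_eq_one_iff_adj.2 h2
      omega
  have hlow : ∀ x y (w : B.G.Walk x y), (x.1 : ℕ) ≤ w.length + (y.1 : ℕ) := by
    intro x y w
    induction w with
    | nil => simp
    | cons h w ih =>
      rw [SimpleGraph.Walk.length_cons]
      rcases (hadj _ _).1 h with h | h
      · have := h.1; omega
      · have := h.1; omega
  have hdist : ∀ x, B.G.dist x B.root = (x.1 : ℕ) := by
    intro x
    apply le_antisymm (hup _ x rfl)
    obtain ⟨w, hw⟩ := B.isTree.1.exists_walk_length_eq_dist x B.root
    have := hlow _ _ w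
    rw [hw] at this
    have h0 : (B.root.1 : ℕ) = 0 := by rw [hroot]
    omega
  have hdeg : ∀ x, 1 ≤ (x.1 : ℕ) →
      B.degree x = 1 + if (x.1 : ℕ) + 1 < p then k else 0 := by
    intro x hx
    obtain ⟨u, hu⟩ := hpar x hx
    have h1 : {v | B.G.Adj x v} = {u} ∪ {v | IsParent x v} := by
      ext v
      simp only [Set.mem_ofPred_eq, hadj, Set.mem_union, Set.mem_singleton_iff]
      constructor
      · rintro (h | h)
        · exact Or.inr h
        · exact Or.inl (parent_unique_aux h hu)
      · rintro (rfl | h)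
        · exact Or.inr hu
        · exact Or.inl h
    unfold RTree.degree
    rw [Nat.card_coe_set_eq, h1, Set.ncard_union_eq, children_card_aux, Set.ncard_singleton]
    rw [Set.disjoint_singleton_left]
    intro h
    have := hu.1
    have := h.1
    omega
  have hm : B.moment = ∑ l ∈ Finset.range p, k ^ l * (l * (1 + if l + 1 < p then k else 0)) := by
    unfold RTree.moment
    obtain ⟨g, hg⟩ : ∃ g : ℕ → ℕ, ∀ l, g l = l * (1 + if l + 1 < p then k else 0) :=
      ⟨_, fun _ => rfl⟩
    simp only [← hg]
    have h1 : ∀ x, B.G.dist x B.root * B.degree x = g (x.1 : ℕ) := by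
      intro x
      rw [hdist, hg]
      rcases Nat.eq_zero_or_pos (x.1 : ℕ) with h | h
      · rw [h]; simp
      · rw [hdeg x h]
    rw [Finset.sum_congr rfl fun x _ => h1 x, Fintype.sum_sigma, Finset.sum_range]
    refine Finset.sum_congr rfl fun l _ => ?_
    dsimp only
    rw [Finset.sum_const, smul_eq_mul, Finset.card_univ, ← Nat.card_eq_fintype_card]
    congr 1
    simp
  obtain ⟨q, rfl⟩ : ∃ q, p = q + 1 := ⟨p - 1, by omega⟩
  have hk1 : (k : ℝ) - 1 ≠ 0 := by
    have : (2 : ℝ) ≤ k := by exact_mod_cast hk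
    intro h
    linarith
  have hs := moment_sum_aux (k : ℝ) hk1 q
  rw [hm, Finset.sum_range_succ]
  push_cast
  rw [← hs]
  congr 1
  · refine Finset.sum_congr rfl fun l hl => ?_
    rw [if_pos (by have := Finset.mem_range.1 hl; omega)]
  · simp
end

section
/- Let T_1 and T_2 be rooted trees of orders n_1 and n_2, with path matrices N_1 and N_2 and roots r_1 and r_2. Then the path matrix of the rooted product T_1 ⊠ T_2 is permutationally similar to I_{n_1} ⊗ N_2 + (N_1 − I_{n_1}) ⊗ e_{r_2} eᵀ, where ⊗ is the Kronecker product, e_{r_2} is the standard unit vector of dimension n_2 indexed by r_2, and e is the all-ones vector of dimension n_2. -/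
open Matrix SimpleGraph
open scoped Kronecker

attribute [local instance 10] Classical.propDecidable

/-- The explicit distance function of the rooted product. -/
noncomputable def rpD {V₁ V₂ : Type} (T₁ : RTree V₁) (T₂ : RTree V₂) (x y : V₁ × V₂) : ℕ :=
  if x.1 = y.1 then T₂.G.dist x.2 y.2
  else T₂.G.dist x.2 T₂.root + T₁.G.dist x.1 y.1 + T₂.G.dist T₂.root y.2

theorem rpD_step {V₁ V₂ : Type} (T₁ : RTree V₁) (T₂ : RTree V₂) (i j k : V₁) (a b c : V₂)
    (h : (i = j ∧ T₂.G.Adj a b) ∨ (T₁.G.Adj i j ∧ a = T₂.root ∧ b = T₂.root)) :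
    rpD T₁ T₂ (i, a) (k, c) ≤ 1 + rpD T₁ T₂ (j, b) (k, c) := by
  have c1 := T₁.isTree.1
  have c2 := T₂.isTree.1
  unfold rpD
  rcases h with ⟨rfl, h⟩ | ⟨h, rfl, rfl⟩
  · have hab : T₂.G.dist a b = 1 := SimpleGraph.dist_eq_one_iff_adj.2 h
    have t1 := c2.dist_triangle (u := a) (v := b) (w := c)
    have t2 := c2.dist_triangle (u := a) (v := b) (w := T₂.root)
    split_ifs <;> dsimp only <;> omega
  · have hab : T₁.G.dist i j = 1 := SimpleGraph.dist_eq_one_iff_adj.2 h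
    have t1 := c1.dist_triangle (u := i) (v := j) (w := k)
    have hr : T₂.G.dist T₂.root T₂.root = 0 := SimpleGraph.dist_self
    dsimp only
    split_ifs with h1 h2 h2
    · omega
    · omega
    · subst h2; omega
    · omega

theorem rp_dist {V₁ V₂ : Type} (T₁ : RTree V₁) (T₂ : RTree V₂) (S : RTree (V₁ × V₂))
    (hadj : ∀ (i j : V₁) (a b : V₂), S.G.Adj (i, a) (j, b) ↔
      (i = j ∧ T₂.G.Adj a b) ∨ (T₁.G.Adj i j ∧ a = T₂.root ∧ b = T₂.root))
    (x y : V₁ × V₂) : S.G.dist x y = rpD T₁ T₂ x y := by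
  have c1 := T₁.isTree.1
  have c2 := T₂.isTree.1
  have c := S.isTree.1
  apply le_antisymm
  · have f2 : ∀ i a b, S.G.dist (i, a) (i, b) ≤ T₂.G.dist a b := by
      intro i a b
      obtain ⟨p, hp⟩ := c2.exists_walk_length_eq_dist a b
      let f : T₂.G →g S.G := ⟨fun a => (i, a), fun {a b} h => (hadj _ _ _ _).2 (Or.inl ⟨rfl, h⟩)⟩
      have := SimpleGraph.dist_le (p.map f)
      rw [SimpleGraph.Walk.length_map, hp] at this
      exact this
    have f1 : ∀ i j, S.G.dist (i, T₂.root) (j, T₂.root) ≤ T₁.G.dist i j := by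
      intro i j
      obtain ⟨p, hp⟩ := c1.exists_walk_length_eq_dist i j
      let f : T₁.G →g S.G :=
        ⟨fun i => (i, T₂.root), fun {a b} h => (hadj _ _ _ _).2 (Or.inr ⟨h, rfl, rfl⟩)⟩
      have := SimpleGraph.dist_le (p.map f)
      rw [SimpleGraph.Walk.length_map, hp] at this
      exact this
    obtain ⟨i, a⟩ := x
    obtain ⟨j, b⟩ := y
    unfold rpD
    dsimp only
    split_ifs with h
    · subst h; exact f2 _ _ _
    · have t1 := c.dist_triangle (u := (i, a)) (v := (i, T₂.root)) (w := (j, b))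
      have t2 := c.dist_triangle (u := (i, T₂.root)) (v := (j, T₂.root)) (w := (j, b))
      have := f2 i a T₂.root
      have := f2 j T₂.root b
      have := f1 i j
      omega
  · obtain ⟨p, hp⟩ := c.exists_walk_length_eq_dist x y
    rw [← hp]
    clear hp
    induction p with
    | nil => simp [rpD]
    | cons h p ih =>
      rename_i u v w
      have := rpD_step T₁ T₂ u.1 v.1 w.1 u.2 v.2 w.2 ((hadj _ _ _ _).1 h)
      simp only [Prod.mk.eta] at this
      rw [SimpleGraph.Walk.length_cons]
      omega

/-- Let `S = T₁ ⊠ T₂` be the rooted product (vertex set `V₁ × V₂`,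
with a copy of `T₂` for every vertex of `T₁`, roots of copies joined according to the
edges of `T₁`, rooted at the root of the copy at the root of `T₁`). Then the path
matrix of `S` is permutationally similar to
`I_{n₁} ⊗ N₂ + (N₁ − I_{n₁}) ⊗ e_{r₂} eᵀ`. -/
theorem pathMatrix_rooted_product {V₁ V₂ : Type} [Fintype V₁] [Fintype V₂]
    (T₁ : RTree V₁) (T₂ : RTree V₂)
    (S : RTree (V₁ × V₂))
    (hroot : S.root = (T₁.root, T₂.root))
    (hadj : ∀ (i j : V₁) (a b : V₂), S.G.Adj (i, a) (j, b) ↔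
      (i = j ∧ T₂.G.Adj a b) ∨ (T₁.G.Adj i j ∧ a = T₂.root ∧ b = T₂.root)) :
    ∃ σ : Equiv.Perm (V₁ × V₂),
      S.pathMatrix =
        ((1 : Matrix V₁ V₁ ℝ) ⊗ₖ T₂.pathMatrix +
          (T₁.pathMatrix - 1) ⊗ₖ
            Matrix.vecMulVec (fun a : V₂ => if a = T₂.root then (1 : ℝ) else 0)
              (fun _ : V₂ => (1 : ℝ))).submatrix σ σ := by
  refine ⟨1, ?_⟩
  have c1 := T₁.isTree.1
  have c2 := T₂.isTree.1
  have hr1 : T₁.G.dist T₁.root T₁.root = 0 := SimpleGraph.dist_self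
  have hR : ∀ i a, rpD T₁ T₂ (i, a) S.root = T₂.G.dist a T₂.root + T₁.G.dist i T₁.root := by
    intro i a
    have hr : T₂.G.dist T₂.root T₂.root = 0 := SimpleGraph.dist_self
    rw [hroot]
    unfold rpD
    dsimp only
    split_ifs with h
    · subst h; omega
    · omega
  ext ⟨i, a⟩ ⟨j, b⟩
  have key : S.pord (j, b) (i, a) ↔
      (i = j ∧ T₂.pord b a) ∨ (i ≠ j ∧ a = T₂.root ∧ T₁.pord j i) := by
    unfold RTree.pord
    simp only [rp_dist T₁ T₂ S hadj, hR]
    unfold rpD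
    dsimp only
    by_cases h : i = j
    · subst h; simp; omega
    · have h' : ¬ j = i := fun e => h e.symm
      have e1 : a = T₂.root ↔ T₂.G.dist a T₂.root = 0 := (c2.dist_eq_zero_iff).symm
      have e2 : T₂.G.dist T₂.root a = T₂.G.dist a T₂.root := SimpleGraph.dist_comm
      have t1 := c1.dist_triangle (u := j) (v := i) (w := T₁.root)
      rw [if_neg h', e1]
      simp only [h, false_and, false_or, ne_eq, not_false_eq_true, true_and]
      omega
  have hii : T₁.pord i i := by simp [RTree.pord]
  simp only [RTree.pathMatrix, Matrix.submatrix_apply, Matrix.add_apply, Matrix.sub_apply,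
    Matrix.kroneckerMap_apply, Matrix.of_apply, Matrix.vecMulVec_apply, Equiv.Perm.one_apply, key]
  by_cases h : i = j
  · subst h
    simp [hii]
  · by_cases ha : a = T₂.root <;> simp [h, ha]
end

section
/- Let T_1 and T_2 be rooted trees of orders n_1 and n_2, with path matrices N_1, N_2, neckbottle matrices Q_1 = N_1N_1ᵀ, Q_2 = N_2N_2ᵀ, and roots r_1, r_2. Then the neckbottle matrix of the rooted product T_1 ⊠ T_2 is permutationally similar to I_{n_1} ⊗ Q_2 + (N_1ᵀ − I_{n_1}) ⊗ N_2 e e_{r_2}ᵀ + (N_1 − I_{n_1}) ⊗ e_{r_2} eᵀ N_2ᵀ + n_2 (Q_1 − N_1 − N_1ᵀ + I_{n_1}) ⊗ e_{r_2} e_{r_2}ᵀ, where ⊗ is the Kronecker product, e_{r_2} is the standard unit vector of dimension n_2 indexed by r_2, and e is the all-ones vector of dimension n_2. -/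
open Matrix SimpleGraph
open scoped Kronecker

attribute [local instance 10] Classical.propDecidable

namespace RTree

variable {V₁ V₂ : Type}

/-- The distance function of the rooted product. -/
noncomputable def prodDist (T₁ : RTree V₁) (T₂ : RTree V₂) (x y : V₁ × V₂) : ℕ :=
  T₁.G.dist x.1 y.1 + if x.1 = y.1 then T₂.G.dist x.2 y.2
    else T₂.G.dist x.2 T₂.root + T₂.G.dist T₂.root y.2

theorem prod_dist_eq (T₁ : RTree V₁) (T₂ : RTree V₂) (S : RTree (V₁ × V₂))
    (hadj : ∀ (i j : V₁) (a b : V₂), S.G.Adj (i, a) (j, b) ↔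
      (i = j ∧ T₂.G.Adj a b) ∨ (T₁.G.Adj i j ∧ a = T₂.root ∧ b = T₂.root))
    (x y : V₁ × V₂) : S.G.dist x y = prodDist T₁ T₂ x y := by
  have c1 := T₁.isTree.connected
  have c2 := T₂.isTree.connected
  have cS := S.isTree.connected
  apply le_antisymm
  · obtain ⟨i, a⟩ := x
    obtain ⟨j, b⟩ := y
    have h2 : ∀ (i : V₁) (a b : V₂), S.G.dist (i, a) (i, b) ≤ T₂.G.dist a b := by
      intro i a b
      obtain ⟨w, hw⟩ := c2.exists_walk_length_eq_dist a b
      let f : T₂.G →g S.G := ⟨fun a => (i, a), fun {a b} h => (hadj i i a b).2 (Or.inl ⟨rfl, h⟩)⟩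
      have := SimpleGraph.dist_le (w.map f)
      rw [SimpleGraph.Walk.length_map, hw] at this
      exact this
    have h1 : ∀ (i j : V₁), S.G.dist (i, T₂.root) (j, T₂.root) ≤ T₁.G.dist i j := by
      intro i j
      obtain ⟨w, hw⟩ := c1.exists_walk_length_eq_dist i j
      let f : T₁.G →g S.G := ⟨fun a => (a, T₂.root),
        fun {a b} h => (hadj a b _ _).2 (Or.inr ⟨h, rfl, rfl⟩)⟩
      have := SimpleGraph.dist_le (w.map f)
      rw [SimpleGraph.Walk.length_map, hw] at this
      exact this
    unfold prodDist
    by_cases hij : i = j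
    · subst hij
      simpa using h2 i a b
    · simp only [hij, if_false]
      have t1 := cS.dist_triangle (u := (i, a)) (v := (i, T₂.root)) (w := (j, b))
      have t2 := cS.dist_triangle (u := (i, T₂.root)) (v := (j, T₂.root)) (w := (j, b))
      have := h2 i a T₂.root
      have := h2 j T₂.root b
      have := h1 i j
      omega
  · obtain ⟨w, hw⟩ := cS.exists_walk_length_eq_dist x y
    rw [← hw]
    clear hw
    induction w with
    | nil => simp [prodDist]
    | @cons x x' y h w ih =>
      rw [SimpleGraph.Walk.length_cons]
      refine le_trans ?_ (Nat.add_le_add_right ih 1)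
      clear ih w
      obtain ⟨i, a⟩ := x
      obtain ⟨i', a'⟩ := x'
      obtain ⟨j, b⟩ := y
      unfold prodDist
      rcases (hadj _ _ _ _).1 h with ⟨rfl, h2⟩ | ⟨h2, rfl, rfl⟩
      · have e : T₂.G.dist a a' = 1 := SimpleGraph.dist_eq_one_iff_adj.2 h2
        have t1 := c2.dist_triangle (u := a) (v := a') (w := b)
        have t2 := c2.dist_triangle (u := a) (v := a') (w := T₂.root)
        dsimp only
        split_ifs <;> omega
      · have e : T₁.G.dist i i' = 1 := SimpleGraph.dist_eq_one_iff_adj.2 h2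
        have t1 := c1.dist_triangle (u := i) (v := i') (w := j)
        have z : T₂.G.dist T₂.root T₂.root = 0 := SimpleGraph.dist_self
        dsimp only
        split_ifs <;> omega

theorem pord_prod (T₁ : RTree V₁) (T₂ : RTree V₂) (S : RTree (V₁ × V₂))
    (hroot : S.root = (T₁.root, T₂.root))
    (hadj : ∀ (i j : V₁) (a b : V₂), S.G.Adj (i, a) (j, b) ↔
      (i = j ∧ T₂.G.Adj a b) ∨ (T₁.G.Adj i j ∧ a = T₂.root ∧ b = T₂.root))
    (i j : V₁) (a b : V₂) : S.pord (j, b) (i, a) ↔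
      if i = j then T₂.pord b a else (a = T₂.root ∧ T₁.pord j i) := by
  have c1 := T₁.isTree.connected
  have c2 := T₂.isTree.connected
  have hr : ∀ (i : V₁) (a : V₂), prodDist T₁ T₂ (i, a) (T₁.root, T₂.root) =
      T₁.G.dist i T₁.root + T₂.G.dist a T₂.root := by
    intro i a
    simp [prodDist]
  unfold pord
  rw [hroot, prod_dist_eq T₁ T₂ S hadj, prod_dist_eq T₁ T₂ S hadj, prod_dist_eq T₁ T₂ S hadj,
    hr, hr]
  unfold prodDist
  by_cases hij : i = j
  · subst hij
    simp
    omega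
  · have hji : ¬ j = i := fun h => hij h.symm
    simp only [hij, hji, if_false]
    have t1 := c1.dist_triangle (u := j) (v := i) (w := T₁.root)
    have e : a = T₂.root ↔ T₂.G.dist a T₂.root = 0 := c2.dist_eq_zero_iff.symm
    rw [e, SimpleGraph.dist_comm (u := T₂.root) (v := a)]
    omega

theorem pathMatrix_prod [Fintype V₁] [Fintype V₂]
    (T₁ : RTree V₁) (T₂ : RTree V₂) (S : RTree (V₁ × V₂))
    (hroot : S.root = (T₁.root, T₂.root))
    (hadj : ∀ (i j : V₁) (a b : V₂), S.G.Adj (i, a) (j, b) ↔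
      (i = j ∧ T₂.G.Adj a b) ∨ (T₁.G.Adj i j ∧ a = T₂.root ∧ b = T₂.root)) :
    S.pathMatrix = (1 : Matrix V₁ V₁ ℝ) ⊗ₖ T₂.pathMatrix + (T₁.pathMatrix - 1) ⊗ₖ
      Matrix.vecMulVec (fun a : V₂ => if a = T₂.root then (1 : ℝ) else 0)
        (fun _ : V₂ => (1 : ℝ)) := by
  ext ⟨i, a⟩ ⟨j, b⟩
  have hp := pord_prod T₁ T₂ S hroot hadj i j a b
  simp only [Matrix.add_apply, Matrix.kroneckerMap_apply, Matrix.sub_apply,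
    Matrix.vecMulVec_apply, pathMatrix, Matrix.of_apply, hp]
  by_cases hij : i = j
  · subst hij
    have : T₁.pord i i := by simp [pord]
    simp [this]
  · by_cases ha : a = T₂.root <;> simp [hij, ha]

end RTree

/-- Let `S = T₁ ⊠ T₂` be the rooted product (vertex set `V₁ × V₂`,
with a copy of `T₂` for every vertex of `T₁`, roots of copies joined according to the
edges of `T₁`, rooted at the root of the copy at the root of `T₁`). Then the
neckbottle matrix of `S` is permutationally similar to
`I_{n₁} ⊗ Q₂ + (N₁ᵀ − I) ⊗ N₂ e e_{r₂}ᵀ + (N₁ − I) ⊗ e_{r₂} eᵀ N₂ᵀ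
  + n₂ (Q₁ − N₁ − N₁ᵀ + I) ⊗ e_{r₂} e_{r₂}ᵀ`. -/
theorem neckbottle_rooted_product {V₁ V₂ : Type} [Fintype V₁] [Fintype V₂]
    (T₁ : RTree V₁) (T₂ : RTree V₂)
    (S : RTree (V₁ × V₂))
    (hroot : S.root = (T₁.root, T₂.root))
    (hadj : ∀ (i j : V₁) (a b : V₂), S.G.Adj (i, a) (j, b) ↔
      (i = j ∧ T₂.G.Adj a b) ∨ (T₁.G.Adj i j ∧ a = T₂.root ∧ b = T₂.root)) :
    ∃ σ : Equiv.Perm (V₁ × V₂),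
      S.neckbottle =
        ((1 : Matrix V₁ V₁ ℝ) ⊗ₖ T₂.neckbottle +
          (T₁.pathMatrixᵀ - 1) ⊗ₖ
            Matrix.vecMulVec (T₂.pathMatrix *ᵥ fun _ : V₂ => (1 : ℝ))
              (fun a : V₂ => if a = T₂.root then (1 : ℝ) else 0) +
          (T₁.pathMatrix - 1) ⊗ₖ
            Matrix.vecMulVec (fun a : V₂ => if a = T₂.root then (1 : ℝ) else 0)
              (T₂.pathMatrix *ᵥ fun _ : V₂ => (1 : ℝ)) +
          (Fintype.card V₂ : ℝ) •
            ((T₁.neckbottle - T₁.pathMatrix - T₁.pathMatrixᵀ + 1) ⊗ₖ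
              Matrix.vecMulVec (fun a : V₂ => if a = T₂.root then (1 : ℝ) else 0)
                (fun a : V₂ => if a = T₂.root then (1 : ℝ) else 0))).submatrix σ σ := by
  refine ⟨Equiv.refl _, ?_⟩
  simp only [Equiv.coe_refl, Matrix.submatrix_id_id]
  have hQ : T₁.neckbottle - T₁.pathMatrix - T₁.pathMatrixᵀ + 1 =
      (T₁.pathMatrix - 1) * (T₁.pathMatrixᵀ - 1) := by
    unfold RTree.neckbottle
    noncomm_ring
  rw [hQ]
  unfold RTree.neckbottle
  rw [RTree.pathMatrix_prod T₁ T₂ S hroot hadj]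
  have kt : ∀ (A : Matrix V₁ V₁ ℝ) (B : Matrix V₂ V₂ ℝ), (A ⊗ₖ B)ᵀ = Aᵀ ⊗ₖ Bᵀ :=
    fun A B => rfl
  have hv : ∀ u v : V₂ → ℝ, (Matrix.vecMulVec u v)ᵀ = Matrix.vecMulVec v u := by
    intro u v
    ext a b
    simp [Matrix.vecMulVec_apply, mul_comm]
  have h1 : ∀ (M : Matrix V₂ V₂ ℝ) (u v : V₂ → ℝ),
      M * Matrix.vecMulVec u v = Matrix.vecMulVec (M *ᵥ u) v := by
    intro M u v
    rw [Matrix.mul_vecMulVec]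
  have h2 : ∀ (M : Matrix V₂ V₂ ℝ) (u v : V₂ → ℝ),
      Matrix.vecMulVec u v * Mᵀ = Matrix.vecMulVec u (M *ᵥ v) := by
    intro M u v
    rw [Matrix.vecMulVec_mul, Matrix.vecMul_transpose]
  have h3 : ∀ (u : V₂ → ℝ),
      Matrix.vecMulVec u (fun _ => (1 : ℝ)) * Matrix.vecMulVec (fun _ => (1 : ℝ)) u =
        (Fintype.card V₂ : ℝ) • Matrix.vecMulVec u u := by
    intro u
    ext a b
    simp [Matrix.mul_apply, Matrix.vecMulVec_apply]
  rw [Matrix.transpose_add, kt, kt, hv, Matrix.transpose_sub, Matrix.transpose_one,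
    Matrix.mul_add, Matrix.add_mul, Matrix.add_mul, ← Matrix.mul_kronecker_mul,
    ← Matrix.mul_kronecker_mul, ← Matrix.mul_kronecker_mul, ← Matrix.mul_kronecker_mul,
    h1, h2, h3, Matrix.kronecker_smul]
  simp only [Matrix.one_mul, Matrix.mul_one]
  abel
end

section
/- Let T_1 and T_2 be rooted trees of orders n_1 and n_2. Then μ(T_1 ⊠ T_2) = μ(T_1) + n_1·μ(T_2) + 2(n_2 − 1)·t(T_1), where μ denotes the moment and t the root-transmission. -/
open Matrix SimpleGraph
open scoped Kronecker

attribute [local instance 10] Classical.propDecidable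

theorem aux_potential {V : Type} (G : SimpleGraph V) (f : V → ℕ)
    (hf : ∀ x y, G.Adj x y → f x ≤ f y + 1) {x y : V} (p : G.Walk x y) :
    f x ≤ f y + p.length := by
  induction p with
  | nil => simp
  | cons h p ih =>
    have := hf _ _ h
    simp only [SimpleGraph.Walk.length_cons]
    omega

theorem aux_dist_hom {V W : Type} (G : SimpleGraph V) (H : SimpleGraph W) (hG : G.Connected)
    (f : G →g H) (x y : V) : H.dist (f x) (f y) ≤ G.dist x y := by
  obtain ⟨p, hp⟩ := hG.exists_walk_length_eq_dist x y
  rw [← hp, ← SimpleGraph.Walk.length_map f p]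
  exact SimpleGraph.dist_le _

theorem aux_adj_dist {V : Type} (G : SimpleGraph V) (hG : G.Connected) {x y : V} (r : V)
    (h : G.Adj x y) : G.dist x r ≤ G.dist y r + 1 := by
  have h1 := hG.dist_triangle (u := x) (v := y) (w := r)
  have h2 : G.dist x y = 1 := SimpleGraph.dist_eq_one_iff_adj.mpr h
  omega

theorem aux_sum_degree {V : Type} [Fintype V] (T : RTree V) :
    (∑ v : V, T.degree v) + 2 = 2 * Fintype.card V := by
  have h1 := T.G.sum_degrees_eq_twice_card_edges
  have h2 := T.isTree.card_edgeFinset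
  have h3 : ∀ v, T.degree v = T.G.degree v := by
    intro v
    unfold RTree.degree
    rw [← SimpleGraph.card_neighborSet_eq_degree, ← Nat.card_eq_fintype_card]
    rfl
  simp only [h3]
  omega

theorem aux_degree {V₁ V₂ : Type} [Fintype V₁] [Fintype V₂]
    (T₁ : RTree V₁) (T₂ : RTree V₂) (S : RTree (V₁ × V₂))
    (hadj : ∀ (i j : V₁) (a b : V₂), S.G.Adj (i, a) (j, b) ↔
      (i = j ∧ T₂.G.Adj a b) ∨ (T₁.G.Adj i j ∧ a = T₂.root ∧ b = T₂.root))
    (i : V₁) (a : V₂) :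
    S.degree (i, a) = T₂.degree a + if a = T₂.root then T₁.degree i else 0 := by
  unfold RTree.degree
  simp only [Nat.card_coe_set_eq]
  have e2 : Function.Injective (fun b : V₂ => (i, b)) := fun _ _ h => (Prod.mk.inj h).2
  have e1 : Function.Injective (fun j : V₁ => (j, T₂.root)) := fun _ _ h => (Prod.mk.inj h).1
  split_ifs with ha
  · rw [← Set.ncard_image_of_injective _ e2, ← Set.ncard_image_of_injective _ e1,
      ← Set.ncard_union_eq]
    · congr 1
      ext ⟨j, b⟩
      simp only [Set.mem_ofPred_eq, hadj, Set.mem_union, Set.mem_image, Prod.mk.injEq]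
      grind
    · rw [Set.disjoint_left]
      rintro _ ⟨b, _, rfl⟩ ⟨j, hj, h⟩
      have : j = i := (Prod.mk.inj h).1
      subst this
      exact T₁.G.loopless.irrefl _ hj
  · rw [← Set.ncard_image_of_injective _ e2, add_zero]
    congr 1
    ext ⟨j, b⟩
    simp only [Set.mem_ofPred_eq, hadj, Set.mem_image, Prod.mk.injEq]
    grind

theorem aux_dist {V₁ V₂ : Type}
    (T₁ : RTree V₁) (T₂ : RTree V₂) (S : RTree (V₁ × V₂))
    (hroot : S.root = (T₁.root, T₂.root))
    (hadj : ∀ (i j : V₁) (a b : V₂), S.G.Adj (i, a) (j, b) ↔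
      (i = j ∧ T₂.G.Adj a b) ∨ (T₁.G.Adj i j ∧ a = T₂.root ∧ b = T₂.root))
    (i : V₁) (a : V₂) :
    S.G.dist (i, a) S.root = T₁.G.dist i T₁.root + T₂.G.dist a T₂.root := by
  have c1 := T₁.isTree.connected
  have c2 := T₂.isTree.connected
  have cS := S.isTree.connected
  rw [hroot]
  apply le_antisymm
  · have h1 := cS.dist_triangle (u := (i, a)) (v := (i, T₂.root)) (w := (T₁.root, T₂.root))
    let f2 : T₂.G →g S.G := ⟨fun b => (i, b), fun {b c} h => (hadj _ _ _ _).2 (Or.inl ⟨rfl, h⟩)⟩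
    let f1 : T₁.G →g S.G :=
      ⟨fun j => (j, T₂.root), fun {b c} h => (hadj _ _ _ _).2 (Or.inr ⟨h, rfl, rfl⟩)⟩
    have h2 : S.G.dist (i, a) (i, T₂.root) ≤ _ := aux_dist_hom _ _ c2 f2 a T₂.root
    have h3 : S.G.dist (i, T₂.root) (T₁.root, T₂.root) ≤ _ := aux_dist_hom _ _ c1 f1 i T₁.root
    omega
  · obtain ⟨p, hp⟩ := cS.exists_walk_length_eq_dist (i, a) (T₁.root, T₂.root)
    have := aux_potential S.G
      (fun x => T₁.G.dist x.1 T₁.root + T₂.G.dist x.2 T₂.root) (by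
        rintro ⟨j, b⟩ ⟨k, c⟩ h
        rcases (hadj _ _ _ _).1 h with ⟨rfl, h'⟩ | ⟨h', rfl, rfl⟩
        · have := aux_adj_dist _ c2 T₂.root h'
          dsimp only
          omega
        · have := aux_adj_dist _ c1 T₁.root h'
          dsimp only
          omega) p
    simp only [SimpleGraph.dist_self] at this
    omega

/-- Let `S = T₁ ⊠ T₂` be the rooted product (vertex set `V₁ × V₂`,
with a copy of `T₂` for every vertex of `T₁`, roots of copies joined according to the
edges of `T₁`, rooted at the root of the copy at the root of `T₁`). Then
`μ(S) = μ(T₁) + n₁ μ(T₂) + 2(n₂ − 1) t(T₁)`. -/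
theorem moment_rooted_product {V₁ V₂ : Type} [Fintype V₁] [Fintype V₂]
    (T₁ : RTree V₁) (T₂ : RTree V₂)
    (n₁ n₂ : ℕ) (hn₁ : n₁ = Fintype.card V₁) (hn₂ : n₂ = Fintype.card V₂)
    (S : RTree (V₁ × V₂))
    (hroot : S.root = (T₁.root, T₂.root))
    (hadj : ∀ (i j : V₁) (a b : V₂), S.G.Adj (i, a) (j, b) ↔
      (i = j ∧ T₂.G.Adj a b) ∨ (T₁.G.Adj i j ∧ a = T₂.root ∧ b = T₂.root)) :
    (S.moment : ℝ) = (T₁.moment : ℝ) + (n₁ : ℝ) * (T₂.moment : ℝ) +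
      2 * ((n₂ : ℝ) - 1) * (T₁.transmission : ℝ) := by
  subst hn₁ hn₂
  have hs := aux_sum_degree T₂
  have hs' : ((∑ v : V₂, T₂.degree v : ℕ) : ℝ) = 2 * ((Fintype.card V₂ : ℝ) - 1) := by
    have : (((∑ v : V₂, T₂.degree v) + 2 : ℕ) : ℝ) = ((2 * Fintype.card V₂ : ℕ) : ℝ) := by
      rw [hs]
    push_cast at this ⊢
    linarith
  rw [← hs']
  have key : S.moment = T₁.moment + Fintype.card V₁ * T₂.moment +
      (∑ v : V₂, T₂.degree v) * T₁.transmission := by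
    unfold RTree.moment RTree.transmission
    rw [Fintype.sum_prod_type]
    have inner : ∀ i : V₁, ∑ a : V₂, S.G.dist (i, a) S.root * S.degree (i, a) =
        T₁.G.dist i T₁.root * T₁.degree i + ∑ a : V₂, T₂.G.dist a T₂.root * T₂.degree a +
        (∑ v : V₂, T₂.degree v) * T₁.G.dist i T₁.root := by
      intro i
      have : ∀ a : V₂, S.G.dist (i, a) S.root * S.degree (i, a) =
          (if a = T₂.root then T₁.G.dist i T₁.root * T₁.degree i else 0) +
          T₂.G.dist a T₂.root * T₂.degree a + T₂.degree a * T₁.G.dist i T₁.root := by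
        intro a
        rw [aux_dist T₁ T₂ S hroot hadj, aux_degree T₁ T₂ S hadj]
        split_ifs with ha
        · subst ha
          simp only [SimpleGraph.dist_self]
          ring
        · ring
      simp only [this, Finset.sum_add_distrib, Finset.sum_mul, Finset.sum_ite_eq',
        Finset.mem_univ, if_true]
    simp only [inner, Finset.sum_add_distrib, Finset.mul_sum, Finset.sum_const,
      Finset.card_univ, smul_eq_mul]
  rw [key]
  push_cast
  ring
end

section
/- Let T be a rooted tree of order n ≥ 2 and let k ≥ 1 be an integer. Then ρ(T)·n^{k−1} ≤ ρ(T^{⊠k}) ≤ ρ(T)·(n^k − 1)/(n − 1), where T^{⊠k} is the k-th rooted power of T and ρ denotes the Perron value. -/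
open Matrix SimpleGraph
open scoped Kronecker

attribute [local instance 10] Classical.propDecidable

/-- one step towards the root -/
def RTree.pstep {V : Type} (T : RTree V) (a b : V) : Prop :=
  T.G.Adj a b ∧ T.G.dist a T.root = T.G.dist b T.root + 1

theorem RTree.exists_pstep {V : Type} (T : RTree V) (a b : V) (h : T.pord a b) (hab : a ≠ b) :
    ∃ c, T.pstep a c ∧ T.pord c b ∧ T.G.dist a b = T.G.dist c b + 1 := by
  have hc := T.isTree.1
  obtain ⟨p, hp⟩ := hc.exists_walk_length_eq_dist a b
  cases p with
  | nil => exact absurd rfl hab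
  | cons hadj q =>
    rename_i c
    have h1 : T.G.dist c b ≤ q.length := SimpleGraph.dist_le q
    have h2 : T.G.dist a c = 1 := SimpleGraph.dist_eq_one_iff_adj.2 hadj
    have h3 := hc.dist_triangle (u := a) (v := c) (w := b)
    have h4 := hc.dist_triangle (u := a) (v := c) (w := T.root)
    have h5 := hc.dist_triangle (u := c) (v := b) (w := T.root)
    simp only [SimpleGraph.Walk.length_cons] at hp
    unfold RTree.pord at *
    refine ⟨c, ⟨hadj, ?_⟩, ?_, ?_⟩ <;> omega

theorem RTree.pord_iff {V : Type} (T : RTree V) (a b : V) :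
    T.pord a b ↔ Relation.ReflTransGen T.pstep a b := by
  have hc := T.isTree.1
  constructor
  · intro h
    induction hd : T.G.dist a b generalizing a with
    | zero =>
      rw [hc.dist_eq_zero_iff.1 hd]
    | succ d ih =>
      have hab : a ≠ b := by
        rintro rfl
        simp at hd
      obtain ⟨c, h1, h2, h3⟩ := T.exists_pstep a b h hab
      exact Relation.ReflTransGen.head h1 (ih c h2 (by omega))
  · intro h
    induction h using Relation.ReflTransGen.head_induction_on with
    | refl => simp [RTree.pord]
    | head h1 _ ih =>
      rename_i a c _
      obtain ⟨hadj, h1⟩ := h1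
      have h2 : T.G.dist a c = 1 := SimpleGraph.dist_eq_one_iff_adj.2 hadj
      have h3 := hc.dist_triangle (u := a) (v := c) (w := b)
      have h4 := hc.dist_triangle (u := a) (v := b) (w := T.root)
      unfold RTree.pord at *
      omega

theorem RTree.pord_root_s14 {V : Type} (T : RTree V) (a : V) : T.pord a T.root := by
  simp [RTree.pord]

/-- steps on words -/
def RTree.wstep {V : Type} (T : RTree V) (k : ℕ) (x y : Fin k → V) : Prop :=
  ∃ m : Fin k, (∀ j : Fin k, j < m → x j = y j) ∧ T.pstep (x m) (y m) ∧
        ∀ j : Fin k, m < j → x j = T.root ∧ y j = T.root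

theorem RTree.wstep_succ {V : Type} (T : RTree V) (k : ℕ) (a b : V) (x y : Fin k → V) :
    T.wstep (k+1) (Fin.cons a x) (Fin.cons b y) ↔
      (a = b ∧ T.wstep k x y) ∨
      (T.pstep a b ∧ x = (fun _ => T.root) ∧ y = (fun _ => T.root)) := by
  unfold RTree.wstep
  rw [Fin.exists_fin_succ]
  simp [Fin.forall_fin_succ, funext_iff, forall_and]
  constructor
  · rintro (h | ⟨i, ⟨h1, h2⟩, h3⟩)
    · exact Or.inr h
    · exact Or.inl ⟨h1, i, h2, h3⟩
  · rintro (⟨h1, i, h2, h3⟩ | h)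
    · exact Or.inr ⟨i, ⟨h1, h2⟩, h3⟩
    · exact Or.inl h

theorem RTree.exists_wstep {V : Type} (T : RTree V) (k : ℕ) (x : Fin k → V)
    (hx : x ≠ fun _ => T.root) : ∃ y, T.wstep k x y := by
  induction k with
  | zero => exact absurd (Subsingleton.elim _ _) hx
  | succ k ih =>
    induction x using Fin.consCases with
    | cons a x =>
    by_cases h : x = fun _ => T.root
    · have ha : a ≠ T.root := by
        rintro rfl
        apply hx
        funext i
        refine Fin.cases ?_ (fun i => ?_) i <;> simp [h]
      obtain ⟨c, hc, _⟩ := T.exists_pstep a T.root (T.pord_root_s14 a) ha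
      exact ⟨Fin.cons c x, (T.wstep_succ k _ _ _ _).2 (Or.inr ⟨hc, h, h⟩)⟩
    · obtain ⟨y, hy⟩ := ih x h
      exact ⟨Fin.cons a y, (T.wstep_succ k _ _ _ _).2 (Or.inl ⟨rfl, hy⟩)⟩

theorem RTree.wsum {V : Type} (T : RTree V) (k : ℕ) (x y : Fin k → V) (m : Fin k)
    (h1 : ∀ j : Fin k, j < m → x j = y j)
    (h2 : ∀ j : Fin k, m < j → x j = T.root ∧ y j = T.root) :
    ∑ i, T.G.dist (x i) T.root + T.G.dist (y m) T.root
      = ∑ i, T.G.dist (y i) T.root + T.G.dist (x m) T.root := by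
  rw [← Finset.add_sum_erase _ _ (Finset.mem_univ m),
    ← Finset.add_sum_erase (a := m) _ (fun i => T.G.dist (y i) T.root) (Finset.mem_univ m)]
  have : ∑ i ∈ Finset.univ.erase m, T.G.dist (x i) T.root
      = ∑ i ∈ Finset.univ.erase m, T.G.dist (y i) T.root := by
    refine Finset.sum_congr rfl fun i hi => ?_
    have hne := Finset.ne_of_mem_erase hi
    rcases lt_or_gt_of_ne hne with h | h
    · rw [h1 i h]
    · rw [(h2 i h).1, (h2 i h).2]
  omega

theorem RTree.wstep_sum {V : Type} (T : RTree V) (k : ℕ) (x y : Fin k → V)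
    (h : T.wstep k x y) :
    ∑ i, T.G.dist (x i) T.root = ∑ i, T.G.dist (y i) T.root + 1 := by
  obtain ⟨m, h1, h2, h3⟩ := h
  have := T.wsum k x y m h1 h3
  have := h2.2
  omega

theorem RTree.power_dist {V : Type} (T : RTree V) (k : ℕ)
    (S : RTree (Fin k → V))
    (hroot : S.root = fun _ => T.root)
    (hadj : ∀ x y : Fin k → V, S.G.Adj x y ↔
      ∃ m : Fin k, (∀ j : Fin k, j < m → x j = y j) ∧ T.G.Adj (x m) (y m) ∧
        ∀ j : Fin k, m < j → x j = T.root ∧ y j = T.root) (x : Fin k → V) :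
    S.G.dist x S.root = ∑ i, T.G.dist (x i) T.root := by
  have hc := S.isTree.1
  have hcT := T.isTree.1
  apply le_antisymm
  · induction hd : ∑ i, T.G.dist (x i) T.root generalizing x with
    | zero =>
      have : x = S.root := by
        rw [hroot]
        funext i
        have := Finset.sum_eq_zero_iff.1 hd i (Finset.mem_univ i)
        exact hcT.dist_eq_zero_iff.1 this
      simp [this]
    | succ d ih =>
      have hx : x ≠ fun _ => T.root := by
        rintro rfl
        simp at hd
      obtain ⟨y, hy⟩ := T.exists_wstep k x hx
      have hs := T.wstep_sum k x y hy
      have h1 := ih y (by omega)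
      have h2 : S.G.Adj x y := by
        rw [hadj]
        obtain ⟨m, h1, h2, h3⟩ := hy
        exact ⟨m, h1, h2.1, h3⟩
      have h3 : S.G.dist x y = 1 := SimpleGraph.dist_eq_one_iff_adj.2 h2
      have h4 := hc.dist_triangle (u := x) (v := y) (w := S.root)
      omega
  · obtain ⟨p, hp⟩ := hc.exists_walk_length_eq_dist x S.root
    rw [← hp]
    have key : ∀ (a b : Fin k → V) (p : S.G.Walk a b),
        ∑ i, T.G.dist (a i) T.root ≤ p.length + ∑ i, T.G.dist (b i) T.root := by
      intro a b p
      induction p with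
      | nil => simp
      | cons h q ih =>
        rename_i u v w
        obtain ⟨m, h1, h2, h3⟩ := (hadj _ _).1 h
        have h4 := T.wsum k u v m h1 h3
        have h5 : T.G.dist (u m) (v m) = 1 := SimpleGraph.dist_eq_one_iff_adj.2 h2
        have h6 := hcT.dist_triangle (u := u m) (v := v m) (w := T.root)
        simp only [SimpleGraph.Walk.length_cons]
        omega
    have h0 : ∑ i, T.G.dist (S.root i) T.root = 0 := by simp [hroot]
    have := key _ _ p
    omega

theorem RTree.power_pstep {V : Type} (T : RTree V) (k : ℕ)
    (S : RTree (Fin k → V))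
    (hroot : S.root = fun _ => T.root)
    (hadj : ∀ x y : Fin k → V, S.G.Adj x y ↔
      ∃ m : Fin k, (∀ j : Fin k, j < m → x j = y j) ∧ T.G.Adj (x m) (y m) ∧
        ∀ j : Fin k, m < j → x j = T.root ∧ y j = T.root) :
    S.pstep = T.wstep k := by
  ext x y
  unfold RTree.pstep
  rw [T.power_dist k S hroot hadj, T.power_dist k S hroot hadj]
  constructor
  · rintro ⟨h, h'⟩
    obtain ⟨m, h1, h2, h3⟩ := (hadj _ _).1 h
    have := T.wsum k x y m h1 h3
    exact ⟨m, h1, ⟨h2, by omega⟩, h3⟩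
  · intro h
    refine ⟨?_, T.wstep_sum k x y h⟩
    obtain ⟨m, h1, h2, h3⟩ := h
    exact (hadj _ _).2 ⟨m, h1, h2.1, h3⟩

/-- the word order -/
def RTree.word {V : Type} (T : RTree V) (k : ℕ) (x y : Fin k → V) : Prop :=
  Relation.ReflTransGen (T.wstep k) x y

theorem RTree.word_root {V : Type} (T : RTree V) (k : ℕ) (x : Fin k → V) :
    T.word k x (fun _ => T.root) := by
  induction hd : ∑ i, T.G.dist (x i) T.root generalizing x with
  | zero =>
    have : x = fun _ => T.root := by
      funext i
      have := Finset.sum_eq_zero_iff.1 hd i (Finset.mem_univ i)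
      exact T.isTree.1.dist_eq_zero_iff.1 this
    rw [this]
    exact Relation.ReflTransGen.refl
  | succ d ih =>
    have hx : x ≠ fun _ => T.root := by
      rintro rfl
      simp at hd
    obtain ⟨y, hy⟩ := T.exists_wstep k x hx
    have hs := T.wstep_sum k x y hy
    exact Relation.ReflTransGen.head hy (ih y (by omega))

theorem RTree.word_succ {V : Type} (T : RTree V) (k : ℕ) (a b : V) (x y : Fin k → V) :
    T.word (k+1) (Fin.cons a x) (Fin.cons b y) ↔
      (a = b ∧ T.word k x y) ∨ (T.pord a b ∧ y = (fun _ => T.root)) := by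
  have lift : ∀ (a : V) (x y : Fin k → V), T.word k x y →
      T.word (k+1) (Fin.cons a x) (Fin.cons a y) := by
    intro a x y h
    exact Relation.ReflTransGen.lift (fun z : Fin k → V => (Fin.cons a z : Fin (k+1) → V))
      (fun u v huv => (T.wstep_succ k _ _ _ _).2 (Or.inl ⟨rfl, huv⟩)) _ _ h
  constructor
  · intro h
    have key : ∀ u v : Fin (k+1) → V, T.word (k+1) u v →
        (u 0 = v 0 ∧ T.word k (Fin.tail u) (Fin.tail v)) ∨
          (T.pord (u 0) (v 0) ∧ Fin.tail v = (fun _ => T.root)) := by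
      intro u v h
      induction h using Relation.ReflTransGen.head_induction_on with
      | refl => exact Or.inl ⟨rfl, Relation.ReflTransGen.refl⟩
      | head h1 _ ih =>
        rename_i p q _
        rw [← Fin.cons_self_tail p, ← Fin.cons_self_tail q, T.wstep_succ] at h1
        rcases h1 with ⟨e, h1⟩ | ⟨h1, e1, e2⟩
        · rcases ih with ⟨e', ih⟩ | ⟨ih, e'⟩
          · exact Or.inl ⟨e.trans e', Relation.ReflTransGen.head h1 ih⟩
          · exact Or.inr ⟨e ▸ ih, e'⟩
        · right
          rcases ih with ⟨e', ih⟩ | ⟨ih, e'⟩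
          · refine ⟨?_, ?_⟩
            · rw [T.pord_iff, ← e']
              exact Relation.ReflTransGen.single h1
            · rw [e2] at ih
              rcases Relation.ReflTransGen.cases_head ih with h | ⟨c, h, _⟩
              · exact h.symm
              · have := T.wstep_sum k _ _ h
                simp at this
          · refine ⟨?_, e'⟩
            rw [T.pord_iff] at ih ⊢
            exact Relation.ReflTransGen.head h1 ih
    simpa using key _ _ h
  · rintro (⟨rfl, h⟩ | ⟨h, rfl⟩)
    · exact lift _ _ _ h
    · refine Relation.ReflTransGen.trans (lift a x _ (T.word_root k x)) ?_
      rw [T.pord_iff] at h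
      exact Relation.ReflTransGen.lift
        (fun z : V => (Fin.cons z (fun _ => T.root) : Fin (k+1) → V))
        (fun u v huv => (T.wstep_succ k _ _ _ _).2 (Or.inr ⟨huv, rfl, rfl⟩)) _ _ h

/-- quadratic form of a relation -/
noncomputable def qform {V : Type} [Fintype V] (P : V → V → Prop) (w : V → ℝ) : ℝ :=
  ∑ v, (∑ i, if P i v then w i else 0) ^ 2

theorem RTree.bottleneck_form {V : Type} [Fintype V] (T : RTree V) (w : V → ℝ) :
    w ⬝ᵥ (T.bottleneck *ᵥ w) = qform T.pord w := by
  have hM : T.bottleneck = T.pathMatrixᵀ * T.pathMatrix := by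
    ext i j
    simp only [RTree.bottleneck, RTree.pathMatrix, Matrix.mul_apply, Matrix.transpose_apply,
      Matrix.of_apply, ← ite_and, ite_mul, one_mul, zero_mul]
    rw [Nat.card_eq_fintype_card, Fintype.card_subtype]
    simp
  rw [hM, ← Matrix.mulVec_mulVec, Matrix.dotProduct_mulVec, Matrix.vecMul_transpose]
  simp [dotProduct, Matrix.mulVec, qform, sq, RTree.pathMatrix]

theorem RTree.perron_spec {V : Type} [Fintype V] (T : RTree V) :
    (∃ w : V → ℝ, w ≠ 0 ∧ T.bottleneck *ᵥ w = T.perron • w) ∧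
      ∀ w : V → ℝ, w ⬝ᵥ (T.bottleneck *ᵥ w) ≤ T.perron * (w ⬝ᵥ w) := by
  have hH : T.bottleneck.IsHermitian := by
    ext i j
    simp [RTree.bottleneck, and_comm]
  have hne : Nonempty V := ⟨T.root⟩
  set L := Matrix.toEuclideanLin T.bottleneck with hL
  have hsym : L.IsSymmetric := Matrix.isSymmetric_toEuclideanLin_iff.2 hH
  have hev := hsym.hasEigenvalue_iSup_of_finiteDimensional
  set lam : ℝ := ⨆ x : { x : EuclideanSpace ℝ V // x ≠ 0 },
    RCLike.re (inner ℝ (L x) (x : EuclideanSpace ℝ V)) / ‖(x : EuclideanSpace ℝ V)‖ ^ 2 with hlam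
  have hray : ∀ x : EuclideanSpace ℝ V, inner ℝ (L x) x ≤ lam * ‖x‖ ^ 2 := by
    intro x
    by_cases hx : x = 0
    · simp [hx]
    have hxp : 0 < ‖x‖ ^ 2 := by positivity
    rw [← div_le_iff₀ hxp]
    refine le_ciSup (f := fun x : { x : EuclideanSpace ℝ V // x ≠ 0 } =>
      RCLike.re (inner ℝ (L x) (x : EuclideanSpace ℝ V)) / ‖(x : EuclideanSpace ℝ V)‖ ^ 2)
      ?_ ⟨x, hx⟩
    refine ⟨‖LinearMap.toContinuousLinearMap L‖, ?_⟩
    rintro _ ⟨⟨y, hy⟩, rfl⟩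
    have hyp : 0 < ‖y‖ ^ 2 := by positivity
    change inner ℝ (L y) y / ‖y‖ ^ 2 ≤ _
    rw [div_le_iff₀ hyp]
    refine (real_inner_le_norm _ _).trans ?_
    have := (LinearMap.toContinuousLinearMap L).le_opNorm y
    rw [sq, ← mul_assoc]
    exact mul_le_mul_of_nonneg_right this (norm_nonneg _)
  have hray' : ∀ w : V → ℝ, w ⬝ᵥ (T.bottleneck *ᵥ w) ≤ lam * (w ⬝ᵥ w) := by
    intro w
    have := hray (WithLp.toLp 2 w)
    rw [EuclideanSpace.real_norm_sq_eq] at this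
    have h2 : w ⬝ᵥ w = ∑ i, w i ^ 2 := by simp [dotProduct, sq]
    rw [h2]
    simpa [hL, EuclideanSpace.inner_eq_star_dotProduct] using this
  have hex : ∃ w : V → ℝ, w ≠ 0 ∧ T.bottleneck *ᵥ w = lam • w := by
    obtain ⟨v, hv⟩ := hev.exists_hasEigenvector
    refine ⟨WithLp.ofLp v, ?_, ?_⟩
    · intro h
      exact hv.2 (by ext i; exact congrFun h i)
    · have := hv.apply_eq_smul
      exact congrArg WithLp.ofLp this
  have hper : T.perron = lam := by
    refine IsGreatest.csSup_eq ⟨hex, ?_⟩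
    rintro t ⟨w, hw, he⟩
    have h1 := hray' w
    rw [he, dotProduct_smul, smul_eq_mul] at h1
    have h2 : 0 < w ⬝ᵥ w := by
      refine lt_of_le_of_ne ?_ (fun h => hw (dotProduct_self_eq_zero.1 h.symm))
      exact Finset.sum_nonneg fun i _ => mul_self_nonneg _
    exact le_of_mul_le_mul_right h1 h2
  rw [hper]
  exact ⟨hex, hray'⟩

theorem RTree.qform_word_succ {V : Type} [Fintype V] (T : RTree V) (k : ℕ)
    (w : (Fin (k+1) → V) → ℝ) :
    qform (T.word (k+1)) w = qform T.pord (fun a => ∑ t : Fin k → V, w (Fin.cons a t)) +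
      ∑ a, ∑ v ∈ Finset.univ.erase (fun _ => T.root),
        (∑ t : Fin k → V, if T.word k t v then w (Fin.cons a t) else 0) ^ 2 := by
  have hs : ∀ {f : (Fin (k+1) → V) → ℝ}, ∑ x, f x = ∑ a, ∑ t : Fin k → V, f (Fin.cons a t) := by
    intro f
    rw [← (Fin.consEquiv (fun _ => V)).sum_comp, Fintype.sum_prod_type]
    rfl
  unfold qform
  rw [hs, ← Finset.sum_add_distrib]
  refine Finset.sum_congr rfl fun a _ => ?_
  rw [← Finset.add_sum_erase _ _ (Finset.mem_univ (fun _ => T.root))]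
  congr 1
  · rw [hs]
    congr 1
    refine Finset.sum_congr rfl fun b _ => ?_
    have : ∀ t : Fin k → V, T.word (k+1) (Fin.cons b t) (Fin.cons a (fun _ => T.root))
        ↔ T.pord b a := by
      intro t
      rw [T.word_succ]
      constructor
      · rintro (⟨rfl, _⟩ | ⟨h, _⟩)
        · simp [RTree.pord]
        · exact h
      · intro h
        exact Or.inr ⟨h, rfl⟩
    simp only [this]
    split_ifs <;> simp
  · refine Finset.sum_congr rfl fun v hv => ?_
    have hv := Finset.ne_of_mem_erase hv
    rw [hs]
    congr 1
    rw [Finset.sum_eq_single a]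
    · simp [T.word_succ, hv]
    · intro b _ hb
      simp [T.word_succ, hv, hb]
    · simp

theorem RTree.upper {V : Type} [Fintype V] (T : RTree V) (ρ : ℝ) 
    (h : ∀ w : V → ℝ, qform T.pord w ≤ ρ * ∑ i, w i ^ 2) (hρ : 0 ≤ ρ) (k : ℕ) :
    ∀ w : (Fin (k+1) → V) → ℝ, qform (T.word (k+1)) w ≤
      ρ * (∑ i ∈ Finset.range (k+1), (Fintype.card V : ℝ) ^ i) * ∑ x, w x ^ 2 := by
  have hs : ∀ {k : ℕ} {f : (Fin (k+1) → V) → ℝ},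
      ∑ x, f x = ∑ a, ∑ t : Fin k → V, f (Fin.cons a t) := by
    intro k f
    rw [← (Fin.consEquiv (fun _ => V)).sum_comp, Fintype.sum_prod_type]
    rfl
  have main : ∀ k : ℕ, (∀ u : (Fin k → V) → ℝ,
      ∑ v ∈ Finset.univ.erase (fun _ => T.root), (∑ t, if T.word k t v then u t else 0) ^ 2
        ≤ ρ * (∑ i ∈ Finset.range k, (Fintype.card V : ℝ) ^ i) * ∑ x, u x ^ 2) →
      ∀ w : (Fin (k+1) → V) → ℝ, qform (T.word (k+1)) w ≤
      ρ * (∑ i ∈ Finset.range (k+1), (Fintype.card V : ℝ) ^ i) * ∑ x, w x ^ 2 := by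
    intro k ih w
    rw [T.qform_word_succ, Finset.sum_range_succ, mul_add, add_mul, add_comm]
    refine add_le_add ?_ ?_
    · rw [hs, Finset.mul_sum]
      exact Finset.sum_le_sum fun a _ => ih _
    · refine (h _).trans ?_
      rw [mul_assoc]
      refine mul_le_mul_of_nonneg_left ?_ hρ
      rw [hs, Finset.mul_sum]
      refine Finset.sum_le_sum fun a _ => ?_
      refine sq_sum_le_card_mul_sum_sq.trans ?_
      simp
  refine main k ?_
  induction k with
  | zero =>
    intro u
    have : (Finset.univ.erase (fun _ => T.root) : Finset (Fin 0 → V)) = ∅ := by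
      ext x
      simp [Subsingleton.elim x (fun _ => T.root)]
    rw [this]
    simp
  | succ k ih =>
    intro u
    refine le_trans ?_ (main k ih u)
    exact Finset.sum_le_sum_of_subset_of_nonneg (Finset.erase_subset _ _)
      fun _ _ _ => sq_nonneg _

theorem RTree.lower {V : Type} [Fintype V] (T : RTree V) (k : ℕ) (u : V → ℝ) :
    qform T.pord u * ((Fintype.card V : ℝ) ^ k) ^ 2
      ≤ qform (T.word (k+1)) (fun x => u (x 0)) := by
  rw [T.qform_word_succ]
  have h0 : 0 ≤ ∑ a, ∑ v ∈ Finset.univ.erase (fun _ => T.root),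
        (∑ t : Fin k → V, if T.word k t v then
          (fun x : Fin (k+1) → V => u (x 0)) (Fin.cons a t) else 0) ^ 2 :=
    Finset.sum_nonneg fun _ _ => Finset.sum_nonneg fun _ _ => sq_nonneg _
  refine le_trans (le_of_eq ?_) (le_add_of_nonneg_right h0)
  unfold qform
  rw [Finset.sum_mul]
  refine Finset.sum_congr rfl fun v _ => ?_
  rw [← mul_pow, Finset.sum_mul]
  congr 1
  refine Finset.sum_congr rfl fun i _ => ?_
  split_ifs <;> simp [mul_comm]

/-- Let `T` be a rooted tree of order `n ≥ 2` and `k ≥ 1`. The `k`-th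
rooted power `T^{⊠k}` has vertex set `Fin k → V`; two words are adjacent iff they agree
before some position `m`, are `T`-adjacent at `m`, and are constantly the root after
`m`; the root is the constant-root word. Then
`ρ(T)·n^{k−1} ≤ ρ(T^{⊠k}) ≤ ρ(T)·(n^k − 1)/(n − 1)`. -/
theorem perron_rooted_power {V : Type} [Fintype V] (T : RTree V)
    (n : ℕ) (hn : n = Fintype.card V) (hn2 : 2 ≤ n)
    (k : ℕ) (hk : 1 ≤ k)
    (S : RTree (Fin k → V))
    (hroot : S.root = fun _ => T.root)
    (hadj : ∀ x y : Fin k → V, S.G.Adj x y ↔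
      ∃ m : Fin k, (∀ j : Fin k, j < m → x j = y j) ∧ T.G.Adj (x m) (y m) ∧
        ∀ j : Fin k, m < j → x j = T.root ∧ y j = T.root) :
    T.perron * (n : ℝ) ^ (k - 1) ≤ S.perron ∧
      S.perron ≤ T.perron * (((n : ℝ) ^ k - 1) / ((n : ℝ) - 1)) := by
  obtain ⟨k, rfl⟩ : ∃ j, k = j + 1 := ⟨k - 1, by omega⟩
  have hpord : S.pord = T.word (k+1) := by
    ext x y
    rw [S.pord_iff, T.power_pstep (k+1) S hroot hadj]
    rfl
  obtain ⟨⟨u, hu, hTe⟩, hT⟩ := T.perron_spec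
  obtain ⟨⟨z, hz, hSe⟩, hS⟩ := S.perron_spec
  simp only [RTree.bottleneck_form, hpord] at hT hS
  have hsq : ∀ {W : Type} [Fintype W] (w : W → ℝ), w ⬝ᵥ w = ∑ i, w i ^ 2 := by
    intro W _ w
    simp [dotProduct, sq]
  have hpos : ∀ {W : Type} [Fintype W] (w : W → ℝ), w ≠ 0 → 0 < ∑ i, w i ^ 2 := by
    intro W _ w hw
    rw [← hsq]
    exact lt_of_le_of_ne (by rw [hsq]; positivity) (fun h => hw (dotProduct_self_eq_zero.1 h.symm))
  have hTu : qform T.pord u = T.perron * ∑ i, u i ^ 2 := by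
    rw [← T.bottleneck_form, hTe, dotProduct_smul, hsq, smul_eq_mul]
  have hSz : qform (T.word (k+1)) z = S.perron * ∑ i, z i ^ 2 := by
    rw [← hpord, ← S.bottleneck_form, hSe, dotProduct_smul, hsq, smul_eq_mul]
  simp only [hsq] at hT hS
  have hρ : 0 ≤ T.perron := by
    have h1 : 0 ≤ qform T.pord u := Finset.sum_nonneg fun _ _ => sq_nonneg _
    rw [hTu] at h1
    exact nonneg_of_mul_nonneg_left h1 (hpos u hu)
  have hn0 : (0:ℝ) < n := by
    have : 0 < n := by omega
    exact_mod_cast this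
  constructor
  · have h1 := (T.lower k u).trans (hS _)
    have h2 : ∑ x : Fin (k+1) → V, u (x 0) ^ 2 = (n:ℝ) ^ k * ∑ i, u i ^ 2 := by
      rw [← (Fin.consEquiv (fun _ => V)).sum_comp, Fintype.sum_prod_type]
      simp [Fin.consEquiv, hn, Finset.mul_sum]
    rw [h2, hTu, ← hn] at h1
    have h3 := hpos u hu
    have h4 : 0 < (n:ℝ) ^ k * ∑ i, u i ^ 2 := by positivity
    simp only [Nat.add_sub_cancel]
    refine le_of_mul_le_mul_right ?_ h4
    refine le_trans (le_of_eq ?_) h1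
    ring
  · have h1 := T.upper _ hT hρ k z
    rw [hSz, ← hn] at h1
    have h2 := le_of_mul_le_mul_right h1 (hpos z hz)
    rw [geom_sum_eq] at h2
    · exact h2
    · have : n ≠ 1 := by omega
      exact_mod_cast this
end

section
/- Let T be a rooted tree of order n ≥ 2 and let k ≥ 0 be an integer. Then μ(T^{⊠k}) = (μ(T) − 2t(T))·(n^k − 1)/(n − 1) + 2t(T)·k·n^{k−1}, where T^{⊠k} is the k-th rooted power of T, μ the moment, and t the root-transmission. -/
open Matrix SimpleGraph
open scoped Kronecker

attribute [local instance 10] Classical.propDecidable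

namespace RTree

variable {V : Type}

/-- Word degree: sum over positions `m` such that the tail after `m` is the root. -/
noncomputable def wdeg (r : V) (g : V → ℝ) {k : ℕ} (x : Fin k → V) : ℝ :=
  ∑ m : Fin k, if (∀ j : Fin k, m < j → x j = r) then g (x m) else 0

theorem wdeg_cons (r : V) (g : V → ℝ) {k : ℕ} (a : V) (y : Fin k → V) :
    wdeg r g (Fin.cons a y : Fin (k + 1) → V) =
      (if y = (fun _ => r) then g a else 0) + wdeg r g y := by
  unfold wdeg
  rw [Fin.sum_univ_succ]
  congr 1
  · simp [Fin.forall_fin_succ, funext_iff]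
  · simp [Fin.forall_fin_succ]

theorem sum_cons [Fintype V] {k : ℕ} (f : (Fin (k + 1) → V) → ℝ) :
    ∑ x, f x = ∑ a : V, ∑ y : Fin k → V, f (Fin.cons a y : Fin (k + 1) → V) := by
  rw [← (Fin.consEquiv (fun _ : Fin (k + 1) => V)).sum_comp, Fintype.sum_prod_type]
  rfl

theorem sum_wdeg [Fintype V] (r : V) (g : V → ℝ) (n : ℝ) (hn : n = Fintype.card V)
    (hg : ∑ v, g v = 2 * (n - 1)) (k : ℕ) :
    ∑ x : Fin k → V, wdeg r g x = 2 * (n ^ k - 1) := by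
  induction k with
  | zero => simp [wdeg]
  | succ k ih =>
    rw [sum_cons]
    simp only [wdeg_cons, Finset.sum_add_distrib, ih, Finset.sum_ite_eq', Finset.sum_const,
      Finset.sum_ite_eq, Finset.mem_univ, if_true, hg, Finset.card_univ, nsmul_eq_mul, ← hn]
    ring

theorem sum_main [Fintype V] (r : V) (d g : V → ℝ) (hd : d r = 0) (n : ℝ)
    (hn : n = Fintype.card V) (hn1 : n - 1 ≠ 0) (hn0 : n ≠ 0)
    (hg : ∑ v, g v = 2 * (n - 1)) (k : ℕ) :
    ∑ x : Fin k → V, (∑ i, d (x i)) * wdeg r g x =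
      (∑ v, d v * g v - 2 * ∑ v, d v) * ((n ^ k - 1) / (n - 1)) +
        2 * (∑ v, d v) * k * n ^ (k - 1) := by
  induction k with
  | zero => simp
  | succ k ih =>
    have key : ∑ x : Fin (k + 1) → V, (∑ i, d (x i)) * wdeg r g x =
        ∑ v, d v * g v + (∑ v, d v) * (2 * (n ^ k - 1)) +
          n * ∑ x : Fin k → V, (∑ i, d (x i)) * wdeg r g x := by
      rw [sum_cons, ← sum_wdeg r g n hn hg k, Finset.sum_mul, hn]
      have : ∀ a : V, ∑ y : Fin k → V, (∑ i, d ((Fin.cons a y : Fin (k + 1) → V) i)) *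
          wdeg r g (Fin.cons a y : Fin (k + 1) → V) =
          d a * g a + d a * ∑ y : Fin k → V, wdeg r g y +
            ∑ y : Fin k → V, (∑ i, d (y i)) * wdeg r g y := by
        intro a
        have h1 : ∀ y : Fin k → V, (∑ i, d ((Fin.cons a y : Fin (k + 1) → V) i)) *
          wdeg r g (Fin.cons a y : Fin (k + 1) → V) =
          (if y = (fun _ => r) then d a * g a else 0) + d a * wdeg r g y +
            (∑ i, d (y i)) * wdeg r g y := by
          intro y
          rw [wdeg_cons, Fin.sum_univ_succ]
          simp only [Fin.cons_zero, Fin.cons_succ]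
          split_ifs with h
          · subst h
            simp [hd]
            ring
          · ring
        simp only [h1, Finset.sum_add_distrib, Finset.sum_ite_eq', Finset.sum_ite_eq,
          Finset.mem_univ, if_true, Finset.mul_sum]
      simp only [this, Finset.sum_add_distrib, Finset.sum_const, Finset.card_univ, nsmul_eq_mul]
    rw [key, ih]
    rcases k with _ | k
    · simp [hn1]
    · simp only [Nat.add_sub_cancel]
      push_cast
      field_simp
      ring

theorem sum_degree [Fintype V] (T : RTree V) (n : ℕ) (hn : n = Fintype.card V) :
    ∑ v, (T.degree v : ℝ) = 2 * ((n : ℝ) - 1) := by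
  have h1 := sum_degrees_eq_twice_card_edges T.G
  have h2 := T.isTree.card_edgeFinset
  have h3 : ∀ v, T.degree v = T.G.degree v := by
    intro v
    unfold degree
    rw [← SimpleGraph.card_neighborSet_eq_degree, Nat.card_eq_fintype_card]
    exact Fintype.card_congr (Equiv.refl _)
  have h4 : (n : ℝ) - 1 = T.G.edgeFinset.card := by
    rw [hn, ← h2]; push_cast; ring
  rw [h4]
  simp only [h3]
  exact_mod_cast h1

theorem sum_update [Fintype V] {k : ℕ} (f : V → ℕ) (x : Fin k → V) (m : Fin k) (v : V) :
    ∑ i, f (Function.update x m v i) + f (x m) = ∑ i, f (x i) + f v := by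
  rw [← Finset.add_sum_erase _ _ (Finset.mem_univ m),
    ← Finset.add_sum_erase _ (fun i => f (x i)) (Finset.mem_univ m)]
  have : ∑ i ∈ Finset.univ.erase m, f (Function.update x m v i) =
      ∑ i ∈ Finset.univ.erase m, f (x i) := by
    apply Finset.sum_congr rfl
    intro i hi
    rw [Function.update_of_ne (Finset.ne_of_mem_erase hi)]
  rw [this]
  simp
  ring

theorem adj_iff_s15 (T : RTree V) {k : ℕ} (S : RTree (Fin k → V))
    (hadj : ∀ x y : Fin k → V, S.G.Adj x y ↔
      ∃ m : Fin k, (∀ j : Fin k, j < m → x j = y j) ∧ T.G.Adj (x m) (y m) ∧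
        ∀ j : Fin k, m < j → x j = T.root ∧ y j = T.root)
    (x y : Fin k → V) : S.G.Adj x y ↔
    ∃ m v, (∀ j : Fin k, m < j → x j = T.root) ∧ T.G.Adj (x m) v ∧
      y = Function.update x m v := by
  rw [hadj]
  constructor
  · rintro ⟨m, h1, h2, h3⟩
    refine ⟨m, y m, fun j hj => (h3 j hj).1, h2, ?_⟩
    funext j
    rcases lt_trichotomy j m with h | h | h
    · rw [Function.update_of_ne h.ne, h1 j h]
    · subst h; simp
    · rw [Function.update_of_ne h.ne', (h3 j h).1, (h3 j h).2]
  · rintro ⟨m, v, h1, h2, rfl⟩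
    refine ⟨m, fun j hj => by rw [Function.update_of_ne hj.ne], by simpa using h2, fun j hj => ?_⟩
    rw [Function.update_of_ne hj.ne']
    exact ⟨h1 j hj, h1 j hj⟩

theorem degree_word [Fintype V] (T : RTree V) {k : ℕ} (S : RTree (Fin k → V))
    (hadj : ∀ x y : Fin k → V, S.G.Adj x y ↔
      ∃ m : Fin k, (∀ j : Fin k, j < m → x j = y j) ∧ T.G.Adj (x m) (y m) ∧
        ∀ j : Fin k, m < j → x j = T.root ∧ y j = T.root)
    (x : Fin k → V) :
    (S.degree x : ℝ) = wdeg T.root (fun v => (T.degree v : ℝ)) x := by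
  let B : Fin k → Type := fun m =>
    {v : V // (∀ j : Fin k, m < j → x j = T.root) ∧ T.G.Adj (x m) v}
  let F : (Σ m, B m) → {u : Fin k → V | S.G.Adj x u} := fun p =>
    ⟨Function.update x p.1 p.2.1,
      (adj_iff_s15 T S hadj x _).2 ⟨p.1, p.2.1, p.2.2.1, p.2.2.2, rfl⟩⟩
  have hF : Function.Bijective F := by
    constructor
    · rintro ⟨m, v, h1, h2⟩ ⟨m', v', h1', h2'⟩ h
      have h : Function.update x m v = Function.update x m' v' := congrArg Subtype.val h
      have hm : m = m' := by
        by_contra hne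
        have := congrFun h m
        rw [Function.update_self, Function.update_of_ne hne] at this
        exact h2.ne this.symm
      subst hm
      have := congrFun h m
      simp only [Function.update_self] at this
      subst this
      rfl
    · rintro ⟨u, hu⟩
      obtain ⟨m, v, h1, h2, rfl⟩ := (adj_iff_s15 T S hadj x u).1 hu
      exact ⟨⟨m, v, h1, h2⟩, rfl⟩
  have hc : S.degree x = ∑ m, Nat.card (B m) := by
    have : ∀ m, Finite (B m) := fun m => Subtype.finite
    rw [← Nat.card_sigma]
    exact (Nat.card_congr (Equiv.ofBijective F hF)).symm
  rw [hc]
  unfold wdeg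
  push_cast
  apply Finset.sum_congr rfl
  intro m _
  split_ifs with h
  · have : Nat.card (B m) = T.degree (x m) :=
      Nat.card_congr (Equiv.subtypeEquivRight (fun v => ⟨fun q => q.2, fun q => ⟨h, q⟩⟩))
    rw [this]
  · have : IsEmpty (B m) := ⟨fun v => h v.2.1⟩
    simp

theorem dist_word [Fintype V] (T : RTree V) {k : ℕ} (S : RTree (Fin k → V))
    (hroot : S.root = fun _ => T.root)
    (hadj : ∀ x y : Fin k → V, S.G.Adj x y ↔
      ∃ m : Fin k, (∀ j : Fin k, j < m → x j = y j) ∧ T.G.Adj (x m) (y m) ∧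
        ∀ j : Fin k, m < j → x j = T.root ∧ y j = T.root)
    (x : Fin k → V) :
    S.G.dist x S.root = ∑ i, T.G.dist (x i) T.root := by
  apply le_antisymm
  · generalize hN : ∑ i, T.G.dist (x i) T.root = N
    induction N using Nat.strong_induction_on generalizing x with
    | _ N ih =>
      by_cases hx : ∀ i, x i = T.root
      · have : x = S.root := by rw [hroot]; funext i; exact hx i
        rw [this]; simp
      · push Not at hx
        obtain ⟨i, hi⟩ := hx
        obtain ⟨m, hm, hmax⟩ := Finset.exists_max_image
          (Finset.univ.filter fun i => x i ≠ T.root) id ⟨i, by simpa using hi⟩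
        have hm : x m ≠ T.root := by simpa using hm
        have htail : ∀ j, m < j → x j = T.root := by
          intro j hj
          by_contra h
          exact absurd (hmax j (by simpa using h)) (not_le.2 hj)
        obtain ⟨v, hv, hd⟩ : ∃ v, T.G.Adj (x m) v ∧
            T.G.dist v T.root + 1 ≤ T.G.dist (x m) T.root := by
          generalize x m = a at hm
          generalize T.root = r at hm
          obtain ⟨p, hp⟩ := (T.isTree.connected a r).exists_walk_length_eq_dist
          rw [← hp]
          cases p with
          | nil => exact absurd rfl hm
          | cons h q => exact ⟨_, h, by simpa using dist_le q⟩
        have hs := sum_update (fun v => T.G.dist v T.root) x m v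
        have hA : S.G.Adj x (Function.update x m v) :=
          (adj_iff_s15 T S hadj _ _).2 ⟨m, v, htail, hv, rfl⟩
        have h1 := ih _ (by omega) (Function.update x m v) rfl
        have h2 := S.isTree.connected.dist_triangle (u := x) (v := Function.update x m v)
          (w := S.root)
        rw [SimpleGraph.dist_eq_one_iff_adj.2 hA] at h2
        omega
  · obtain ⟨p, hp⟩ := (S.isTree.connected x S.root).exists_walk_length_eq_dist
    rw [← hp]
    have key : ∀ (a b : Fin k → V) (p : S.G.Walk a b),
        ∑ i, T.G.dist (a i) T.root ≤ p.length + ∑ i, T.G.dist (b i) T.root := by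
      intro a b p
      induction p with
      | nil => simp
      | @cons u w b h q ih =>
        obtain ⟨m, v, h1, h2, rfl⟩ := (adj_iff_s15 T S hadj _ _).1 h
        have hs := sum_update (fun v => T.G.dist v T.root) u m v
        have ht := T.isTree.connected.dist_triangle (u := u m) (v := v) (w := T.root)
        rw [SimpleGraph.dist_eq_one_iff_adj.2 h2] at ht
        rw [SimpleGraph.Walk.length_cons]
        omega
    simpa [hroot] using key _ _ p

end RTree

/-- Let `T` be a rooted tree of order `n ≥ 2` and `k ≥ 0`. The `k`-th
rooted power `T^{⊠k}` has vertex set `Fin k → V`; two words are adjacent iff they agree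
before some position `m`, are `T`-adjacent at `m`, and are constantly the root after
`m`; the root is the constant-root word. Then
`μ(T^{⊠k}) = (μ(T) − 2t(T))·(n^k − 1)/(n − 1) + 2t(T)·k·n^{k−1}`. -/
theorem moment_rooted_power {V : Type} [Fintype V] (T : RTree V)
    (n : ℕ) (hn : n = Fintype.card V) (hn2 : 2 ≤ n)
    (k : ℕ)
    (S : RTree (Fin k → V))
    (hroot : S.root = fun _ => T.root)
    (hadj : ∀ x y : Fin k → V, S.G.Adj x y ↔
      ∃ m : Fin k, (∀ j : Fin k, j < m → x j = y j) ∧ T.G.Adj (x m) (y m) ∧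
        ∀ j : Fin k, m < j → x j = T.root ∧ y j = T.root) :
    (S.moment : ℝ) =
      ((T.moment : ℝ) - 2 * (T.transmission : ℝ)) * (((n : ℝ) ^ k - 1) / ((n : ℝ) - 1)) +
        2 * (T.transmission : ℝ) * k * (n : ℝ) ^ (k - 1) := by
  have h := RTree.sum_main T.root (fun v => (T.G.dist v T.root : ℝ)) (fun v => (T.degree v : ℝ))
    (by simp) (n : ℝ) (by rw [hn])
    (by have : (2 : ℝ) ≤ n := by exact_mod_cast hn2
        intro h0; linarith)
    (by have : (2 : ℝ) ≤ n := by exact_mod_cast hn2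
        intro h0; linarith)
    (RTree.sum_degree T n hn) k
  unfold RTree.moment RTree.transmission
  push_cast
  rw [← h]
  apply Finset.sum_congr rfl
  intro x _
  rw [RTree.degree_word T S hadj, RTree.dist_word T S hroot hadj]
  push_cast
  rfl
end
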